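/- Suppose that for some k ∈ (0, k_max) the worst case localiser q̂_k is a density. Then q̂_k is a worst case density for k, unless both θ_min ∈ Θ₂ with G'₊(θ_min) > −∞ and k > k_cr. If θ_min ∈ Θ₂, G'₊(θ_min) > −∞ and k > k_cr, then q̂_k = q̂_{k_cr} = q_{θ_min} and no worst case density exists for k. -/

import Mathlib

open MeasureTheory Filter Set Topology
open scoped ENNReal

noncomputable section

variable {Ω : Type*} [MeasurableSpace Ω]

/-- The positive part of an extended real number, as a member of `ℝ≥0∞`. -/
def ePos (x : EReal) : ℝ≥0∞ := if x = ⊤ then ⊤ else ENNReal.ofReal x.toReal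

/-- The (signed) integral of an extended-real-valued function: the integral of its
positive part minus the integral of its negative part. -/
def eInt (μ : Measure Ω) (f : Ω → EReal) : EReal :=
  ((∫⁻ r, ePos (f r) ∂μ : ℝ≥0∞) : EReal) - ((∫⁻ r, ePos (-(f r)) ∂μ : ℝ≥0∞) : EReal)

/-- `p` is a probability density with respect to `μ`. -/
def IsDensity (μ : Measure Ω) (p : Ω → ℝ) : Prop :=
  Measurable p ∧ (∀ r, 0 ≤ p r) ∧ ∫⁻ r, ENNReal.ofReal (p r) ∂μ = 1

/-- `∫ p dμ` for a nonnegative function `p`. -/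
def pInt (μ : Measure Ω) (p : Ω → ℝ) : ℝ≥0∞ := ∫⁻ r, ENNReal.ofReal (p r) ∂μ

/-- The convex integral functional `H(p) = ∫ β(r, p(r)) μ(dr)`. -/
def Hfun (μ : Measure Ω) (β : Ω → ℝ → EReal) (p : Ω → ℝ) : EReal :=
  eInt μ (fun r => β r (p r))

/-- The expected payoff `∫ X p dμ`, as an extended real number. -/
def xInt (μ : Measure Ω) (X p : Ω → ℝ) : EReal :=
  eInt μ (fun r => ((X r * p r : ℝ) : EReal))

/-- The value function `F(b) = inf { H(p) : p density, ∫ X p dμ = b }`. -/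
def Ffun (μ : Measure Ω) (β : Ω → ℝ → EReal) (X : Ω → ℝ) (b : ℝ) : EReal :=
  ⨅ p : {p : Ω → ℝ // IsDensity μ p ∧ xInt μ X p = (b : EReal)}, Hfun μ β p.1

/-- The essential infimum `m` of `X`, as an extended real number. -/
def essInfX (μ : Measure Ω) (X : Ω → ℝ) : EReal := essInf (fun r => (X r : EReal)) μ

/-- The essential supremum `M` of `X`, as an extended real number. -/
def essSupX (μ : Measure Ω) (X : Ω → ℝ) : EReal := essSup (fun r => (X r : EReal)) μ

/-- `k_max = lim_{b ↓ m} F(b)`; since `F` is nonincreasing on `(m, b₀)`, this limit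
equals the supremum of `F` over `(m, b₀)`. -/
def kmax (μ : Measure Ω) (β : Ω → ℝ → EReal) (X : Ω → ℝ) (b₀ : ℝ) : EReal :=
  ⨆ b : {b : ℝ // essInfX μ X < (b : EReal) ∧ b < b₀}, Ffun μ β X b

/-- `V(k) = inf { ∫ X p dμ : p density, H(p) ≤ k }`. -/
def Vfun (μ : Measure Ω) (β : Ω → ℝ → EReal) (X : Ω → ℝ) (k : ℝ) : EReal :=
  ⨅ p : {p : Ω → ℝ // IsDensity μ p ∧ Hfun μ β p ≤ (k : EReal)}, xInt μ X p.1

/-- `W(λ) = inf { ∫ X p dμ + λ H(p) : p density }`. -/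
def Wfun (μ : Measure Ω) (β : Ω → ℝ → EReal) (X : Ω → ℝ) (lam : ℝ) : EReal :=
  ⨅ p : {p : Ω → ℝ // IsDensity μ p}, (xInt μ X p.1 + (lam : EReal) * Hfun μ β p.1)

/-- The convex conjugate `β*(r, τ) = sup_s (sτ − β(r,s))` of `β` in its second variable. -/
def conjβ (β : Ω → ℝ → EReal) (r : Ω) (τ : ℝ) : EReal :=
  ⨆ s : ℝ, (((s * τ : ℝ) : EReal) - β r s)

/-- `K(θ₁, θ₂) = ∫ β*(r, θ₁ + θ₂ X(r)) μ(dr)`. -/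
def Kfun (μ : Measure Ω) (β : Ω → ℝ → EReal) (X : Ω → ℝ) (θ₁ θ₂ : ℝ) : EReal :=
  eInt μ (fun r => conjβ β r (θ₁ + θ₂ * X r))

/-- `dom K = {(θ₁, θ₂) : K(θ₁,θ₂) < +∞}`. -/
def domK (μ : Measure Ω) (β : Ω → ℝ → EReal) (X : Ω → ℝ) : Set (ℝ × ℝ) :=
  {θ : ℝ × ℝ | Kfun μ β X θ.1 θ.2 < ⊤}

/-- `β'(r, +∞) = lim_{s ↑ ∞} β'(r,s)`; by monotonicity of the derivative of a convex
function this equals the supremum of `β'(r, ·)` over `(0, ∞)`. -/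
def derivTop (β' : Ω → ℝ → ℝ) (r : Ω) : EReal := ⨆ s : {s : ℝ // 0 < s}, (β' r s.1 : EReal)

/-- `β'(r, 0) = lim_{s ↓ 0} β'(r,s)`, the infimum of `β'(r, ·)` over `(0, ∞)`. -/
def derivZero (β' : Ω → ℝ → ℝ) (r : Ω) : EReal := ⨅ s : {s : ℝ // 0 < s}, (β' r s.1 : EReal)

/-- The parameter set `Θ`. -/
def ThetaSet (μ : Measure Ω) (β : Ω → ℝ → EReal) (β' : Ω → ℝ → ℝ) (X : Ω → ℝ) :
    Set (ℝ × ℝ) :=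
  {θ ∈ domK μ β X | ∀ᵐ r ∂μ, ((θ.1 + θ.2 * X r : ℝ) : EReal) < derivTop β' r}

/-- The generalised exponential family member `p_{θ₁,θ₂}(r) = (β*)'(r, θ₁ + θ₂ X(r))`,
where `ψ` denotes the derivative `(β*)'` of the conjugate in its second variable. -/
def pFam (ψ : Ω → ℝ → ℝ) (X : Ω → ℝ) (θ₁ θ₂ : ℝ) : Ω → ℝ :=
  fun r => ψ r (θ₁ + θ₂ * X r)

/-- `G(θ₂) = inf_{θ₁} [K(θ₁,θ₂) − θ₁]`. -/
def Gfun (μ : Measure Ω) (β : Ω → ℝ → EReal) (X : Ω → ℝ) (θ₂ : ℝ) : EReal :=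
  ⨅ θ₁ : ℝ, (Kfun μ β X θ₁ θ₂ - (θ₁ : EReal))

/-- `Θ₂ = dom G`, the projection of `dom K` to the `θ₂`-axis. -/
def Theta2 (μ : Measure Ω) (β : Ω → ℝ → EReal) (X : Ω → ℝ) : Set ℝ :=
  {θ₂ : ℝ | Gfun μ β X θ₂ < ⊤}

/-- The Bregman integrand `Δ_β(r, s, t)`; for `t = 0` it is defined as the limit `t ↓ 0`
(with `β'(r,0) = lim_{t↓0} β'(r,t)`), and if `β(r,0) = +∞` then `Δ_β(r,0,0) = 0` and
`Δ_β(r,s,0) = +∞` for `s > 0`. -/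
def bregmanInt (β : Ω → ℝ → EReal) (β' : Ω → ℝ → ℝ) (r : Ω) (s t : ℝ) : EReal :=
  if 0 < t then β r s - β r t - ((β' r t : EReal) * ((s - t : ℝ) : EReal))
  else if β r 0 = ⊤ then (if s = 0 then 0 else ⊤)
  else β r s - β r 0 - derivZero β' r * ((s : ℝ) : EReal)

/-- The (generalised) Bregman distance `B(p, q)`. -/
def Bdist (μ : Measure Ω) (β : Ω → ℝ → EReal) (β' : Ω → ℝ → ℝ) (p q : Ω → ℝ) : EReal :=
  eInt μ (fun r => bregmanInt β β' r (p r) (q r))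

/-- The standing assumptions of the framework: `μ` is σ-finite; `β` is a normal convex
integrand (measurable in `r`; equal to `+∞` for `s < 0`; finite, strictly convex and
differentiable with derivative `β'` on `(0,∞)`; right-continuous at `0`); `p₀` is a
density with finite expected payoff `b₀` satisfying `m < b₀ < M`; `H(p₀) = 0 ≤ H(p)`
for every density `p`; and `k_max > 0`. -/
structure Standing (μ : Measure Ω) (β : Ω → ℝ → EReal) (β' : Ω → ℝ → ℝ)
    (X : Ω → ℝ) (p₀ : Ω → ℝ) (b₀ : ℝ) : Prop where
  sigma : SigmaFinite μ
  betaMeas : ∀ s : ℝ, Measurable (fun r => β r s)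
  Xmeas : Measurable X
  betaNeg : ∀ r : Ω, ∀ s : ℝ, s < 0 → β r s = ⊤
  betaNeBot : ∀ r s, β r s ≠ ⊥
  betaFin : ∀ r : Ω, ∀ s : ℝ, 0 < s → β r s ≠ ⊤
  betaZero : ∀ r, Tendsto (fun s => β r s) (𝓝[>] (0:ℝ)) (𝓝 (β r 0))
  betaConv : ∀ r, StrictConvexOn ℝ (Ioi (0:ℝ)) (fun s => (β r s).toReal)
  betaDeriv : ∀ r : Ω, ∀ s ∈ Ioi (0:ℝ), HasDerivAt (fun t => (β r t).toReal) (β' r s) s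
  dens₀ : IsDensity μ p₀
  payoff₀ : xInt μ X p₀ = (b₀ : EReal)
  mlt : essInfX μ X < (b₀ : EReal)
  ltM : (b₀ : EReal) < essSupX μ X
  H₀ : Hfun μ β p₀ = 0
  Hnonneg : ∀ p, IsDensity μ p → 0 ≤ Hfun μ β p
  kmaxPos : 0 < kmax μ β X b₀

/-- The hypothesis that `ψ = (β*)'`: at every point `τ < β'(r,+∞)`, where the conjugate
`β*(r,·)` is finite and differentiable, `ψ r τ` is its derivative. -/
def IsConjDeriv (β : Ω → ℝ → EReal) (β' : Ω → ℝ → ℝ) (ψ : Ω → ℝ → ℝ) : Prop :=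
  ∀ r : Ω, ∀ τ : ℝ, ((τ : ℝ) : EReal) < derivTop β' r →
    HasDerivAt (fun t => (conjβ β r t).toReal) (ψ r τ) τ

/-- `(θ₁, θ₂)` with `θ₂ < 0` attains the double maximum
`max_{θ₂<0} max_{θ₁} (k + K(θ₁,θ₂) − θ₁)/θ₂` (whose value is `V(k)`); such a pair is a
parameter pair of the worst case localiser `q̂_k = p_{θ₁,θ₂}`. -/
def IsWCLParam (μ : Measure Ω) (β : Ω → ℝ → EReal) (X : Ω → ℝ) (k : ℝ) (θ₁ θ₂ : ℝ) : Prop :=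
  θ₂ < 0 ∧ ∀ θ₁' θ₂' : ℝ, θ₂' < 0 →
    ((k : EReal) + Kfun μ β X θ₁' θ₂' - (θ₁' : EReal)) / ((θ₂' : ℝ) : EReal) ≤
      ((k : EReal) + Kfun μ β X θ₁ θ₂ - (θ₁ : EReal)) / ((θ₂ : ℝ) : EReal)

/-- `p` is an (ε-γ)-almost worst case density for threshold `k`. -/
def AWCD (μ : Measure Ω) (β : Ω → ℝ → EReal) (X : Ω → ℝ) (k ε γ : ℝ) (p : Ω → ℝ) : Prop :=
  IsDensity μ p ∧ Hfun μ β p ≤ ((k + γ : ℝ) : EReal) ∧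
    xInt μ X p ≤ Vfun μ β X k + (ε : EReal)

/-- Convergence locally in measure. -/
def TendstoLocallyInMeasure (μ : Measure Ω) (p : ℕ → Ω → ℝ) (q : Ω → ℝ) : Prop :=
  ∀ C : Set Ω, MeasurableSet C → μ C < ⊤ → ∀ ε : ℝ, 0 < ε →
    Tendsto (fun n => μ {r ∈ C | ε < |p n r - q r|}) atTop (𝓝 0)

end

/-- In finite dimension a point outside a nonempty convex set is (weakly) separated from it
by a nonzero functional. -/
theorem Convex.exists_ne_zero_forall_le_of_notMem {V : Type*} [NormedAddCommGroup V]
    [NormedSpace ℝ V] [FiniteDimensional ℝ V] {s : Set V} (hs : Convex ℝ s) (hne : s.Nonempty)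
    {x : V} (hx : x ∉ s) : ∃ L : V →L[ℝ] ℝ, L ≠ 0 ∧ ∀ y ∈ s, L y ≤ L x := by
  by_cases hInt : (interior s).Nonempty
  · obtain ⟨L, hL, h⟩ := geometric_hahn_banach_of_nonempty_interior_point hs
      (fun h => hx (interior_subset h)) hInt
    exact ⟨L, hL, h⟩
  · rw [hs.interior_nonempty_iff_affineSpan_eq_top] at hInt
    obtain ⟨y₀, hy₀⟩ := hne
    have hspan : vectorSpan ℝ s < ⊤ := by
      refine lt_top_iff_ne_top.2 fun h => hInt ?_
      rwa [← direction_affineSpan, AffineSubspace.direction_eq_top_iff_of_nonempty] at h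
      exact ⟨y₀, subset_affineSpan ℝ s hy₀⟩
    obtain ⟨f, hf0, hf⟩ := Submodule.exists_le_ker_of_lt_top _ hspan
    have hconst : ∀ y ∈ s, f y = f y₀ := by
      intro y hy
      have := hf (vsub_mem_vectorSpan ℝ hy hy₀)
      rw [LinearMap.mem_ker, vsub_eq_sub, map_sub] at this
      linarith
    have hL : LinearMap.toContinuousLinearMap f ≠ 0 := by
      simpa using hf0
    rcases le_total (f y₀) (f x) with h | h
    · refine ⟨LinearMap.toContinuousLinearMap f, hL, fun y hy => ?_⟩
      simpa [hconst y hy] using h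
    · refine ⟨-LinearMap.toContinuousLinearMap f, neg_ne_zero.2 hL, fun y hy => ?_⟩
      simpa [hconst y hy] using h

section SignedIntegral

variable {Ω : Type*} [MeasurableSpace Ω] {μ : Measure Ω}

theorem ePos_eq_toENNReal (x : EReal) : ePos x = x.toENNReal := rfl

theorem ePos_coe (x : ℝ) : ePos (x : EReal) = ENNReal.ofReal x := by simp [ePos]

theorem ePos_mono {x y : EReal} (h : x ≤ y) : ePos x ≤ ePos y := by
  simpa only [ePos_eq_toENNReal] using EReal.toENNReal_le_toENNReal h

theorem eInt_mono {f g : Ω → EReal} (h : f ≤ᵐ[μ] g) : eInt μ f ≤ eInt μ g := by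
  refine EReal.sub_le_sub ?_ ?_
  · exact_mod_cast lintegral_mono_ae (h.mono fun r hr => ePos_mono hr)
  · exact_mod_cast lintegral_mono_ae (h.mono fun r hr => ePos_mono (EReal.neg_le_neg_iff.2 hr))

theorem eInt_eq_integral {f : Ω → EReal} {g : Ω → ℝ} (h : ∀ᵐ r ∂μ, f r = (g r : EReal))
    (hg : Integrable g μ) : eInt μ f = ((∫ r, g r ∂μ : ℝ) : EReal) := by
  have h1 : ∫⁻ r, ePos (f r) ∂μ = ∫⁻ r, ENNReal.ofReal (g r) ∂μ :=
    lintegral_congr_ae (h.mono fun r hr => by simp only [hr, ePos_coe])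
  have h2 : ∫⁻ r, ePos (-(f r)) ∂μ = ∫⁻ r, ENNReal.ofReal (-(g r)) ∂μ :=
    lintegral_congr_ae (h.mono fun r hr => by
      simp only [hr]; rw [← EReal.coe_neg, ePos_coe])
  have f1 : ∫⁻ r, ENNReal.ofReal (g r) ∂μ ≠ ⊤ := hg.lintegral_lt_top.ne
  have f2 : ∫⁻ r, ENNReal.ofReal (-(g r)) ∂μ ≠ ⊤ := hg.neg.lintegral_lt_top.ne
  rw [eInt, h1, h2, integral_eq_lintegral_pos_part_sub_lintegral_neg_part hg, EReal.coe_sub,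
    EReal.coe_ennreal_toReal f1, EReal.coe_ennreal_toReal f2]

theorem ae_eq_coe_of_eInt {f : Ω → EReal} (hf : AEMeasurable f μ) (h1 : eInt μ f ≠ ⊤)
    (h2 : eInt μ f ≠ ⊥) :
    (∀ᵐ r ∂μ, f r = ((f r).toReal : EReal)) ∧ Integrable (fun r => (f r).toReal) μ := by
  have hB : ∫⁻ r, ePos (-(f r)) ∂μ ≠ ⊤ := by
    intro h
    apply h2
    rw [eInt, h]; simp
  have hA : ∫⁻ r, ePos (f r) ∂μ ≠ ⊤ := by
    intro h
    apply h1
    rw [eInt, h, EReal.coe_ennreal_top, EReal.top_sub]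
    simpa using hB
  have mA : AEMeasurable (fun r => ePos (f r)) μ := by
    simpa only [ePos_eq_toENNReal] using hf.ereal_toENNReal
  have mB : AEMeasurable (fun r => ePos (-(f r))) μ := by
    exact hf.neg.ereal_toENNReal
  have hfin : ∀ᵐ r ∂μ, f r = ((f r).toReal : EReal) := by
    filter_upwards [ae_lt_top' mA hA, ae_lt_top' mB hB] with r hr1 hr2
    rw [EReal.coe_toReal]
    · rintro h; simp [h, ePos] at hr1
    · rintro h; simp [h, ePos] at hr2
  refine ⟨hfin, hf.ereal_toReal.aestronglyMeasurable, ?_⟩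
  rw [hasFiniteIntegral_iff_norm]
  calc ∫⁻ r, ENNReal.ofReal ‖(f r).toReal‖ ∂μ
      ≤ ∫⁻ r, (ePos (f r) + ePos (-(f r))) ∂μ := by
        refine lintegral_mono_ae (hfin.mono fun r hr => ?_)
        conv_rhs => rw [hr, ← EReal.coe_neg, ePos_coe, ePos_coe]
        rcases le_total 0 (f r).toReal with h | h
        · rw [Real.norm_of_nonneg h]; exact le_self_add
        · rw [Real.norm_of_nonpos h]; exact le_add_self
    _ = _ := lintegral_add_left' mA _
    _ < ⊤ := ENNReal.add_lt_top.2 ⟨hA.lt_top, hB.lt_top⟩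

theorem integral_le_eInt {f : Ω → EReal} {g : Ω → ℝ} (h : ∀ᵐ r ∂μ, (g r : EReal) ≤ f r)
    (hg : Integrable g μ) : ((∫ r, g r ∂μ : ℝ) : EReal) ≤ eInt μ f := by
  rw [← eInt_eq_integral (f := fun r => (g r : EReal)) (ae_of_all _ fun _ => rfl) hg]
  exact eInt_mono h

theorem eInt_le_integral {f : Ω → EReal} {g : Ω → ℝ} (h : ∀ᵐ r ∂μ, f r ≤ (g r : EReal))
    (hg : Integrable g μ) : eInt μ f ≤ ((∫ r, g r ∂μ : ℝ) : EReal) := by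
  rw [← eInt_eq_integral (f := fun r => (g r : EReal)) (ae_of_all _ fun _ => rfl) hg]
  exact eInt_mono h

/-- Fatou's lemma for sequences of integrable functions bounded below by an integrable one. -/
theorem integrable_of_tendsto_of_integral_le {V : ℕ → Ω → ℝ} {L B : Ω → ℝ} {c : ℝ}
    (hV : ∀ n, Integrable (V n) μ) (hB : Integrable B μ) (hBV : ∀ n, ∀ᵐ r ∂μ, B r ≤ V n r)
    (hlim : ∀ᵐ r ∂μ, Tendsto (fun n => V n r) atTop (𝓝 (L r)))
    (hc : ∀ n, ∫ r, V n r ∂μ ≤ c) : Integrable L μ ∧ ∫ r, L r ∂μ ≤ c := by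
  have hLm : AEStronglyMeasurable L μ :=
    aestronglyMeasurable_of_tendsto_ae atTop (fun n => (hV n).aestronglyMeasurable) hlim
  have hle : ∀ᵐ r ∂μ, 0 ≤ L r - B r := by
    filter_upwards [hlim, ae_all_iff.2 hBV] with r h1 h2
    have := ge_of_tendsto' h1 h2
    linarith
  have hkey : ∫⁻ r, ENNReal.ofReal (L r - B r) ∂μ ≤ ENNReal.ofReal (c - ∫ r, B r ∂μ) := by
    calc ∫⁻ r, ENNReal.ofReal (L r - B r) ∂μ
        = ∫⁻ r, liminf (fun n => ENNReal.ofReal (V n r - B r)) atTop ∂μ := by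
          refine lintegral_congr_ae (hlim.mono fun r hr => ?_)
          exact ((ENNReal.continuous_ofReal.tendsto _).comp
            (hr.sub_const (B r))).liminf_eq.symm
      _ ≤ liminf (fun n => ∫⁻ r, ENNReal.ofReal (V n r - B r) ∂μ) atTop :=
          lintegral_liminf_le' fun n =>
            ((hV n).sub hB).aemeasurable.ennreal_ofReal
      _ ≤ ENNReal.ofReal (c - ∫ r, B r ∂μ) := by
          refine liminf_le_of_frequently_le' (Frequently.of_forall fun n => ?_)
          have hi : Integrable (fun r => V n r - B r) μ := (hV n).sub hB
          rw [← ofReal_integral_eq_lintegral_ofReal hi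
            ((hBV n).mono fun r hr => by simpa using hr)]
          refine ENNReal.ofReal_le_ofReal ?_
          rw [integral_sub (hV n) hB]
          linarith [hc n]
  have hInt : Integrable (fun r => L r - B r) μ := by
    refine ⟨hLm.sub hB.aestronglyMeasurable, ?_⟩
    rw [hasFiniteIntegral_iff_ofReal hle]
    exact hkey.trans_lt ENNReal.ofReal_lt_top
  have hL : Integrable L μ :=
    (hInt.add hB).congr (ae_of_all _ fun r => by simp)
  refine ⟨hL, ?_⟩
  rw [← ofReal_integral_eq_lintegral_ofReal hInt hle, integral_sub hL hB] at hkey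
  have h0 : 0 ≤ c - ∫ r, B r ∂μ := by
    have := integral_mono_ae hB (hV 0) (hBV 0)
    linarith [hc 0]
  linarith [(ENNReal.ofReal_le_ofReal_iff h0).1 hkey]

end SignedIntegral

namespace Standing

variable {Ω : Type*} [MeasurableSpace Ω] {μ : Measure Ω} {β : Ω → ℝ → EReal}
  {β' : Ω → ℝ → ℝ} {ψ : Ω → ℝ → ℝ} {X p₀ : Ω → ℝ} {b₀ : ℝ}

theorem coe_beta (hst : Standing μ β β' X p₀ b₀) (r : Ω) {s : ℝ} (hs : 0 < s) :
    ((β r s).toReal : EReal) = β r s :=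
  EReal.coe_toReal (hst.betaFin r s hs) (hst.betaNeBot r s)

theorem tangent_le (hst : Standing μ β β' X p₀ b₀) (r : Ω) {s t : ℝ} (hs : 0 < s) (ht : 0 < t) :
    (β r s).toReal + β' r s * (t - s) ≤ (β r t).toReal := by
  have hc := (hst.betaConv r).convexOn
  rcases lt_trichotomy s t with h | h | h
  · have := hc.le_slope_of_hasDerivAt (mem_Ioi.2 hs) (mem_Ioi.2 ht) h
      (hst.betaDeriv r s hs)
    rw [slope_def_field, le_div_iff₀ (by linarith)] at this
    linarith
  · subst h; simp
  · have := hc.slope_le_of_hasDerivAt (mem_Ioi.2 ht) (mem_Ioi.2 hs) h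
      (hst.betaDeriv r s hs)
    rw [slope_def_field, div_le_iff₀ (by linarith)] at this
    linarith

theorem deriv_lt_deriv (hst : Standing μ β β' X p₀ b₀) (r : Ω) {s t : ℝ} (hs : 0 < s)
    (hst' : s < t) : β' r s < β' r t := by
  have hc := hst.betaConv r
  have ht := hs.trans hst'
  exact (hc.lt_slope_of_hasDerivAt (mem_Ioi.2 hs) (mem_Ioi.2 ht) hst'
    (hst.betaDeriv r s hs)).trans
    (hc.slope_lt_of_hasDerivAt (mem_Ioi.2 hs) (mem_Ioi.2 ht) hst' (hst.betaDeriv r t ht))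

theorem conj_le_iff (hst : Standing μ β β' X p₀ b₀) (r : Ω) (τ c : ℝ) :
    conjβ β r τ ≤ (c : EReal) ↔ ∀ s : ℝ, 0 < s → s * τ - (β r s).toReal ≤ c := by
  constructor
  · intro h s hs
    have h1 := (le_iSup (fun s : ℝ => (((s * τ : ℝ) : EReal) - β r s)) s).trans h
    rw [← hst.coe_beta r hs] at h1
    exact_mod_cast h1
  · intro h
    refine iSup_le fun s => ?_
    rcases lt_trichotomy s 0 with hs | hs | hs
    · rw [hst.betaNeg r s hs, EReal.sub_top]; exact bot_le
    · subst hs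
      have h0 : ((-c : ℝ) : EReal) ≤ β r 0 := by
        have hl : Tendsto (fun s : ℝ => ((s * τ - c : ℝ) : EReal)) (𝓝[>] (0:ℝ))
            (𝓝 ((-c : ℝ) : EReal)) := by
          rw [EReal.tendsto_coe]
          have : Tendsto (fun s : ℝ => s * τ - c) (𝓝 0) (𝓝 (0 * τ - c)) :=
            (Continuous.tendsto (by fun_prop) 0)
          simpa using this.mono_left nhdsWithin_le_nhds
        refine le_of_tendsto_of_tendsto hl (hst.betaZero r) ?_
        filter_upwards [self_mem_nhdsWithin] with s hs
        rw [← hst.coe_beta r hs]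
        exact_mod_cast (by linarith [h s hs] : s * τ - c ≤ (β r s).toReal)
      rw [EReal.sub_le_iff_le_add (Or.inl (hst.betaNeBot r 0)) (Or.inr (by simp))]
      have := add_le_add_right h0 (c : EReal)
      calc ((0 * τ : ℝ) : EReal) = (c : EReal) + ((-c : ℝ) : EReal) := by
            rw [← EReal.coe_add]; simp
        _ ≤ _ := this
    · rw [← hst.coe_beta r hs]
      exact_mod_cast h s hs

theorem conj_ne_bot (hst : Standing μ β β' X p₀ b₀) (r : Ω) (τ : ℝ) : conjβ β r τ ≠ ⊥ := by
  intro h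
  have h1 := le_iSup (fun s : ℝ => (((s * τ : ℝ) : EReal) - β r s)) 1
  rw [← hst.coe_beta r one_pos] at h1
  change _ ≤ conjβ β r τ at h1
  rw [h, le_bot_iff, ← EReal.coe_sub] at h1
  exact EReal.coe_ne_bot _ h1

theorem coe_conj (hst : Standing μ β β' X p₀ b₀) (r : Ω) {τ : ℝ} (h : conjβ β r τ ≠ ⊤) :
    ((conjβ β r τ).toReal : EReal) = conjβ β r τ :=
  EReal.coe_toReal h (hst.conj_ne_bot r τ)

theorem mul_sub_le_conj (hst : Standing μ β β' X p₀ b₀) (r : Ω) {s : ℝ} (τ : ℝ)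
    (hs : β r s ≠ ⊤) : ((s * τ - (β r s).toReal : ℝ) : EReal) ≤ conjβ β r τ := by
  have h1 := le_iSup (fun s : ℝ => (((s * τ : ℝ) : EReal) - β r s)) s
  rwa [← EReal.coe_toReal hs (hst.betaNeBot r s), ← EReal.coe_sub] at h1

theorem young (hst : Standing μ β β' X p₀ b₀) (r : Ω) {s τ : ℝ} (hs : β r s ≠ ⊤)
    (h : conjβ β r τ ≠ ⊤) : s * τ - (β r s).toReal ≤ (conjβ β r τ).toReal := by
  have h1 := hst.mul_sub_le_conj r τ hs
  rw [← hst.coe_conj r h] at h1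
  exact_mod_cast h1

theorem conj_mid_le (hst : Standing μ β β' X p₀ b₀) (r : Ω) {τ τ' e : ℝ} (he : 0 ≤ e)
    (he1 : e ≤ 1) (h : conjβ β r τ ≠ ⊤) (h' : conjβ β r τ' ≠ ⊤) :
    conjβ β r (τ + e * (τ' - τ)) ≤
      (((1 - e) * (conjβ β r τ).toReal + e * (conjβ β r τ').toReal : ℝ) : EReal) := by
  rw [hst.conj_le_iff]
  intro s hs
  have h1 := hst.young r (hst.betaFin r s hs) h
  have h2 := hst.young r (hst.betaFin r s hs) h'
  nlinarith

theorem conj_sub_le (hst : Standing μ β β' X p₀ b₀) (r : Ω) {τ e s : ℝ} (he : 0 ≤ e) (hs : 0 < s)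
    (h : conjβ β r τ ≠ ⊤) (hτ : β' r s ≤ τ - e) :
    (conjβ β r (τ - e)).toReal + e * s ≤ (conjβ β r τ).toReal := by
  have hle : conjβ β r (τ - e) ≤ (((conjβ β r τ).toReal - e * s : ℝ) : EReal) := by
    rw [hst.conj_le_iff]
    intro t ht
    rcases le_total s t with h1 | h1
    · have := hst.young r (hst.betaFin r t ht) h
      nlinarith
    · have h2 := hst.tangent_le r hs ht
      have h3 := hst.young r (hst.betaFin r s hs) h
      have h4 : β' r s * (s - t) ≤ (τ - e) * (s - t) :=
        mul_le_mul_of_nonneg_right hτ (by linarith)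
      linarith
  have := EReal.toReal_le_toReal hle (hst.conj_ne_bot r _) (EReal.coe_ne_top _)
  rw [EReal.toReal_coe] at this
  linarith

/-- The conjugate is nondecreasing, since `β(r, s) = +∞` for `s < 0`. -/
theorem conj_sub_mono (hst : Standing μ β β' X p₀ b₀) (r : Ω) {τ e : ℝ} (he : 0 ≤ e)
    (h : conjβ β r τ ≠ ⊤) :
    conjβ β r (τ - e) ≤ conjβ β r τ := by
  rw [← hst.coe_conj r h, hst.conj_le_iff]
  intro t ht
  have := hst.young r (hst.betaFin r t ht) h
  nlinarith

theorem exists_conj_eq (hst : Standing μ β β' X p₀ b₀) (r : Ω) {τ : ℝ}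
    (hτ : (τ : EReal) < derivTop β' r) :
    conjβ β r τ ≠ ⊤ ∧ ∃ s, 0 ≤ s ∧ β r s ≠ ⊤ ∧
      (conjβ β r τ).toReal = s * τ - (β r s).toReal := by
  obtain ⟨⟨s₁, hs₁⟩, hlt⟩ := lt_iSup_iff.1 hτ
  have hlt : τ < β' r s₁ := by exact_mod_cast hlt
  set f : ℝ → EReal := fun s => ((s * τ : ℝ) : EReal) - β r s with hf
  have hβc : ∀ s ∈ Icc 0 s₁, ContinuousWithinAt (β r) (Icc 0 s₁) s := by
    intro s hs
    rcases hs.1.eq_or_lt with h | h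
    · subst h
      have h0 : ContinuousWithinAt (β r) (Ioi 0) 0 := hst.betaZero r
      exact (continuousWithinAt_Ioi_iff_Ici.1 h0).mono fun x hx => hx.1
    · have h1 : ContinuousAt (fun t => (((β r t).toReal : ℝ) : EReal)) s :=
        continuous_coe_real_ereal.continuousAt.comp (hst.betaDeriv r s h).continuousAt
      refine (h1.congr ?_).continuousWithinAt
      filter_upwards [Ioi_mem_nhds h] with t ht using hst.coe_beta r ht
  have hcont : ContinuousOn f (Icc 0 s₁) := by
    intro s hs
    have h1 : ContinuousWithinAt (fun s : ℝ => ((s * τ : ℝ) : EReal)) (Icc 0 s₁) s :=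
      (continuous_coe_real_ereal.comp (by fun_prop)).continuousWithinAt
    have h2 : ContinuousWithinAt (fun s => -β r s) (Icc 0 s₁) s :=
      continuous_neg.continuousAt.comp_continuousWithinAt (hβc s hs)
    exact ContinuousAt.comp_continuousWithinAt (g := fun p : EReal × EReal => p.1 + p.2)
      (f := fun s : ℝ => (((s * τ : ℝ) : EReal), -β r s))
      (EReal.continuousAt_add (Or.inl (EReal.coe_ne_top _)) (Or.inl (EReal.coe_ne_bot _)))
      (h1.prodMk h2)
  obtain ⟨s, hs, hmax⟩ := isCompact_Icc.exists_isMaxOn ⟨0, le_rfl, hs₁.le⟩ hcont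
  have hs₁f : f s₁ = ((s₁ * τ - (β r s₁).toReal : ℝ) : EReal) := by
    rw [hf]; simp only; rw [← hst.coe_beta r hs₁]; rfl
  have hge : f s₁ ≤ f s := hmax ⟨hs₁.le, le_rfl⟩
  have hfin : β r s ≠ ⊤ := by
    intro h
    rw [hs₁f, hf] at hge
    simp only [h, EReal.sub_top, le_bot_iff] at hge
    exact EReal.coe_ne_bot _ hge
  have hsf : f s = ((s * τ - (β r s).toReal : ℝ) : EReal) := by
    rw [hf]; simp only
    rw [← EReal.coe_toReal hfin (hst.betaNeBot r s)]; rfl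
  have hsup : conjβ β r τ = f s := by
    refine le_antisymm ?_ (le_iSup f s)
    rw [hsf, hst.conj_le_iff]
    intro t ht
    rcases le_total t s₁ with h | h
    · have : f t ≤ f s := hmax ⟨ht.le, h⟩
      rw [hsf, hf] at this
      simp only at this
      rw [← hst.coe_beta r ht] at this
      exact_mod_cast this
    · rw [hs₁f, hsf] at hge
      have hge : s₁ * τ - (β r s₁).toReal ≤ s * τ - (β r s).toReal := by exact_mod_cast hge
      have h1 := hst.tangent_le r hs₁ ht
      have h2 : τ * (t - s₁) ≤ β' r s₁ * (t - s₁) :=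
        mul_le_mul_of_nonneg_right hlt.le (by linarith)
      linarith
  rw [hsup, hsf]
  exact ⟨EReal.coe_ne_top _, s, hs.1, hfin, rfl⟩

theorem eq_psi (hst : Standing μ β β' X p₀ b₀) (hψ : IsConjDeriv β β' ψ) (r : Ω) {s τ : ℝ}
    (hτ : (τ : EReal) < derivTop β' r) (hs : β r s ≠ ⊤)
    (h : (conjβ β r τ).toReal = s * τ - (β r s).toReal) : s = ψ r τ := by
  have hmin : IsLocalMin (fun t => (conjβ β r t).toReal - s * t) τ := by
    have hev : ∀ᶠ t : ℝ in 𝓝 τ, (t : EReal) < derivTop β' r :=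
      (continuous_coe_real_ereal.tendsto τ).eventually (Iio_mem_nhds hτ)
    filter_upwards [hev] with t ht
    have := hst.young r hs (hst.exists_conj_eq r ht).1
    linarith
  have hd := (hψ r τ hτ).sub ((hasDerivAt_id τ).const_mul s)
  have := hmin.hasDerivAt_eq_zero hd
  linarith

/-- Equality in the Fenchel–Young inequality at `s = (β*)'(r, τ)`. -/
theorem psi_spec (hst : Standing μ β β' X p₀ b₀) (hψ : IsConjDeriv β β' ψ) (r : Ω) {τ : ℝ}
    (hτ : (τ : EReal) < derivTop β' r) :
    conjβ β r τ ≠ ⊤ ∧ 0 ≤ ψ r τ ∧ β r (ψ r τ) ≠ ⊤ ∧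
      (conjβ β r τ).toReal = ψ r τ * τ - (β r (ψ r τ)).toReal := by
  obtain ⟨h1, s, h2, h3, h4⟩ := hst.exists_conj_eq r hτ
  rw [← hst.eq_psi hψ r hτ h3 h4]
  exact ⟨h1, h2, h3, h4⟩

theorem psi_eq_of_conj_mid (hst : Standing μ β β' X p₀ b₀) (hψ : IsConjDeriv β β' ψ) (r : Ω)
    {τ τ' : ℝ} (hτ : (τ : EReal) < derivTop β' r) (hτ' : (τ' : EReal) < derivTop β' r)
    (h : (conjβ β r τ).toReal + (conjβ β r τ').toReal ≤
      2 * (conjβ β r (τ + 1 / 2 * (τ' - τ))).toReal) : ψ r τ = ψ r τ' := by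
  have hmid : ((τ + 1 / 2 * (τ' - τ) : ℝ) : EReal) < derivTop β' r := by
    rcases le_total τ τ' with hle | hle
    · exact lt_of_le_of_lt (by exact_mod_cast (by linarith)) hτ'
    · exact lt_of_le_of_lt (by exact_mod_cast (by linarith)) hτ
  obtain ⟨-, s, -, hs, heq⟩ := hst.exists_conj_eq r hmid
  have h1 := hst.young r hs (hst.exists_conj_eq r hτ).1
  have h2 := hst.young r hs (hst.exists_conj_eq r hτ').1
  rw [heq] at h
  rw [← hst.eq_psi hψ r hτ hs (by linarith), ← hst.eq_psi hψ r hτ' hs (by linarith)]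

end Standing

/-- `K(a, t)` is finite, expressed through real-valued integrability. -/
def KFin {Ω : Type*} [MeasurableSpace Ω] (μ : Measure Ω) (β : Ω → ℝ → EReal) (X : Ω → ℝ)
    (a t : ℝ) : Prop :=
  (∀ᵐ r ∂μ, conjβ β r (a + t * X r) ≠ ⊤) ∧
    Integrable (fun r => (conjβ β r (a + t * X r)).toReal) μ

/-- The real value of `K(a, t)` wherever it is finite. -/
noncomputable def KReal {Ω : Type*} [MeasurableSpace Ω] (μ : Measure Ω) (β : Ω → ℝ → EReal) (X : Ω → ℝ)
    (a t : ℝ) : ℝ :=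
  ∫ r, (conjβ β r (a + t * X r)).toReal ∂μ

theorem IsDensity.integrable {Ω : Type*} [MeasurableSpace Ω] {μ : Measure Ω} {p : Ω → ℝ}
    (hp : IsDensity μ p) : Integrable p μ := by
  refine ⟨hp.1.aestronglyMeasurable, ?_⟩
  rw [hasFiniteIntegral_iff_ofReal (ae_of_all _ hp.2.1), hp.2.2]
  exact ENNReal.one_lt_top

theorem IsDensity.integral_eq_one {Ω : Type*} [MeasurableSpace Ω] {μ : Measure Ω} {p : Ω → ℝ}
    (hp : IsDensity μ p) : ∫ r, p r ∂μ = 1 := by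
  rw [integral_eq_lintegral_of_nonneg_ae (ae_of_all _ hp.2.1) hp.1.aestronglyMeasurable, hp.2.2]
  simp

theorem isDensity_of_integral_eq_one {Ω : Type*} [MeasurableSpace Ω] {μ : Measure Ω} {p : Ω → ℝ}
    (hm : Measurable p) (h0 : ∀ r, 0 ≤ p r) (hi : Integrable p μ) (h1 : ∫ r, p r ∂μ = 1) :
    IsDensity μ p := by
  refine ⟨hm, h0, ?_⟩
  rw [← ofReal_integral_eq_lintegral_ofReal hi (ae_of_all _ h0), h1, ENNReal.ofReal_one]

theorem xInt_eq_integral {Ω : Type*} [MeasurableSpace Ω] {μ : Measure Ω} {X p : Ω → ℝ}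
    (h : Integrable (fun r => X r * p r) μ) :
    xInt μ X p = ((∫ r, X r * p r ∂μ : ℝ) : EReal) :=
  eInt_eq_integral (ae_of_all _ fun _ => rfl) h

namespace Standing

variable {Ω : Type*} [MeasurableSpace Ω] {μ : Measure Ω} {β : Ω → ℝ → EReal}
  {β' : Ω → ℝ → ℝ} {ψ : Ω → ℝ → ℝ} {X p₀ : Ω → ℝ} {b₀ : ℝ}

theorem measurable_beta_comp (hst : Standing μ β β' X p₀ b₀) {q : Ω → ℝ} (hq : Measurable q)
    (hq0 : ∀ r, 0 ≤ q r) : Measurable (fun r => β r (q r)) := by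
  set Q : ℕ → Ω → ℝ := fun n r => ((⌊q r * ((n : ℝ) + 1)⌋₊ : ℝ) + 1) / ((n : ℝ) + 1)
  have hlt : ∀ n r, q r < Q n r := by
    intro n r
    rw [lt_div_iff₀ (by positivity)]
    exact Nat.lt_floor_add_one _
  have hle : ∀ n r, Q n r ≤ q r + 1 / ((n : ℝ) + 1) := by
    intro n r
    have hn : (0 : ℝ) < (n : ℝ) + 1 := by positivity
    rw [div_le_iff₀ hn, add_mul, one_div, inv_mul_cancel₀ hn.ne']
    have := Nat.floor_le (mul_nonneg (hq0 r) hn.le)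
    linarith
  have hlim : ∀ r, Tendsto (fun n => Q n r) atTop (𝓝 (q r)) := by
    intro r
    refine tendsto_of_tendsto_of_tendsto_of_le_of_le tendsto_const_nhds ?_
      (fun n => (hlt n r).le) (fun n => hle n r)
    simpa using tendsto_one_div_add_atTop_nhds_zero_nat.const_add (q r)
  have hmeas : ∀ n, Measurable (fun r => β r (Q n r)) := by
    intro n
    have h1 : Measurable (fun x : ℕ × Ω => β x.2 (((x.1 : ℝ) + 1) / ((n : ℝ) + 1))) :=
      measurable_from_prod_countable_right fun m => hst.betaMeas (((m : ℝ) + 1) / ((n : ℝ) + 1))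
    exact h1.comp ((Nat.measurable_floor.comp (hq.mul_const _)).prodMk measurable_id)
  refine measurable_of_tendsto_metrizable hmeas (tendsto_pi_nhds.2 fun r => ?_)
  rcases (hq0 r).eq_or_lt with h | h
  · have h0 := hst.betaZero r
    have h2 := hlim r
    have h3 := fun n => hlt n r
    rw [← h] at h2 h3 ⊢
    exact h0.comp (tendsto_nhdsWithin_iff.2 ⟨h2, Eventually.of_forall h3⟩)
  · have h1 : ContinuousAt (β r) (q r) := by
      have h1 : ContinuousAt (fun t => (((β r t).toReal : ℝ) : EReal)) (q r) :=
        continuous_coe_real_ereal.continuousAt.comp (hst.betaDeriv r (q r) h).continuousAt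
      refine h1.congr ?_
      filter_upwards [Ioi_mem_nhds h] with t ht using hst.coe_beta r ht
    exact h1.tendsto.comp (hlim r)

/-- A bound at all positive rational arguments extends to all positive arguments. -/
theorem le_of_forall_rat (hst : Standing μ β β' X p₀ b₀) (r : Ω) {τ z M : ℝ}
    (h : ∀ s : ℚ, 0 < s → (s : ℝ) * τ + z * (β r s).toReal ≤ M) {s : ℝ} (hs : 0 < s) :
    s * τ + z * (β r s).toReal ≤ M := by
  by_contra hlt
  push Not at hlt
  have hc : ContinuousAt (fun s : ℝ => s * τ + z * (β r s).toReal) s :=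
    (continuousAt_id.mul continuousAt_const).add
      (continuousAt_const.mul (hst.betaDeriv r s hs).continuousAt)
  have hev := (hc.eventually (Ioi_mem_nhds hlt)).and (Ioi_mem_nhds hs)
  obtain ⟨q, hq1, hq2⟩ := (Rat.denseRange_cast (𝕜 := ℝ)).exists_mem_open isOpen_interior
    ⟨s, mem_interior_iff_mem_nhds.2 hev⟩ |>.imp fun q hq => interior_subset hq
  exact absurd (h q (by exact_mod_cast hq2)) (not_le.2 hq1)

theorem measurable_conj (hst : Standing μ β β' X p₀ b₀) {τ : Ω → ℝ} (hτ : Measurable τ) :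
    Measurable (fun r => conjβ β r (τ r)) := by
  have heq : (fun r => conjβ β r (τ r)) = fun r => ⨆ s : {s : ℚ // 0 < s},
      (((s.1 : ℝ) * τ r - (β r s.1).toReal : ℝ) : EReal) := by
    funext r
    refine le_antisymm ?_ (iSup_le fun s => ?_)
    · refine EReal.le_of_forall_lt_iff_le.1 fun c hc => ?_
      rw [hst.conj_le_iff]
      intro s hs
      have := hst.le_of_forall_rat r (τ := τ r) (z := -1) (M := c) (fun q hq => ?_) hs
      · linarith
      · have h1 := (le_iSup (fun s : {s : ℚ // 0 < s} =>
          (((s.1 : ℝ) * τ r - (β r s.1).toReal : ℝ) : EReal)) ⟨q, hq⟩).trans hc.le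
        have h1 : (q : ℝ) * τ r - (β r q).toReal ≤ c := by exact_mod_cast h1
        linarith
    · exact hst.mul_sub_le_conj r (τ r) (hst.betaFin r _ (by exact_mod_cast s.2))
  rw [heq]
  refine Measurable.iSup fun s => Measurable.coe_real_ereal ?_
  exact (hτ.const_mul _).sub (hst.betaMeas _).ereal_toReal

theorem hfun_fin (hst : Standing μ β β' X p₀ b₀) {p : Ω → ℝ} (hp : IsDensity μ p)
    (h : Hfun μ β p ≠ ⊤) :
    (∀ᵐ r ∂μ, β r (p r) ≠ ⊤) ∧ Integrable (fun r => (β r (p r)).toReal) μ ∧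
      Hfun μ β p = ((∫ r, (β r (p r)).toReal ∂μ : ℝ) : EReal) := by
  have hb : Hfun μ β p ≠ ⊥ := fun hb => by
    have := hst.Hnonneg p hp
    rw [hb] at this
    simp at this
  obtain ⟨h1, h2⟩ := ae_eq_coe_of_eInt (hst.measurable_beta_comp hp.1 hp.2.1).aemeasurable h hb
  exact ⟨h1.mono fun r hr => hr ▸ EReal.coe_ne_top _, h2, eInt_eq_integral h1 h2⟩

theorem hfun_eq (hst : Standing μ β β' X p₀ b₀) {p : Ω → ℝ}
    (hp : ∀ᵐ r ∂μ, β r (p r) ≠ ⊤) (hi : Integrable (fun r => (β r (p r)).toReal) μ) :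
      Hfun μ β p = ((∫ r, (β r (p r)).toReal ∂μ : ℝ) : EReal) :=
  eInt_eq_integral (hp.mono fun r hr => (EReal.coe_toReal hr (hst.betaNeBot r _)).symm) hi

theorem xInt_fin (hst : Standing μ β β' X p₀ b₀) {p : Ω → ℝ} (hp : IsDensity μ p) {b : ℝ}
    (h : xInt μ X p = (b : EReal)) :
    Integrable (fun r => X r * p r) μ ∧ ∫ r, X r * p r ∂μ = b := by
  have hm : Measurable (fun r => ((X r * p r : ℝ) : EReal)) :=
    (hst.Xmeas.mul hp.1).coe_real_ereal
  obtain ⟨-, h2⟩ := ae_eq_coe_of_eInt (μ := μ) hm.aemeasurable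
    (by change xInt μ X p ≠ ⊤; rw [h]; exact EReal.coe_ne_top _)
    (by change xInt μ X p ≠ ⊥; rw [h]; exact EReal.coe_ne_bot _)
  simp only [EReal.toReal_coe] at h2
  refine ⟨h2, ?_⟩
  have := eInt_eq_integral (f := fun r => ((X r * p r : ℝ) : EReal)) (ae_of_all _ fun _ => rfl) h2
  change xInt μ X p = _ at this
  rw [h] at this
  exact_mod_cast this.symm

theorem base_fin (hst : Standing μ β β' X p₀ b₀) :
    (∀ᵐ r ∂μ, β r (p₀ r) ≠ ⊤) ∧ Integrable (fun r => (β r (p₀ r)).toReal) μ ∧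
      ∫ r, (β r (p₀ r)).toReal ∂μ = 0 := by
  obtain ⟨h1, h2, h3⟩ := hst.hfun_fin hst.dens₀ (by rw [hst.H₀]; exact EReal.zero_ne_top)
  rw [hst.H₀] at h3
  exact ⟨h1, h2, by exact_mod_cast h3.symm⟩

theorem base_le_conj (hst : Standing μ β β' X p₀ b₀) (a t : ℝ) :
    (∀ᵐ r ∂μ, ((a * p₀ r + t * (X r * p₀ r) - (β r (p₀ r)).toReal : ℝ) : EReal) ≤
      conjβ β r (a + t * X r)) ∧
    Integrable (fun r => a * p₀ r + t * (X r * p₀ r) - (β r (p₀ r)).toReal) μ ∧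
    ∫ r, (a * p₀ r + t * (X r * p₀ r) - (β r (p₀ r)).toReal) ∂μ = a + t * b₀ := by
  obtain ⟨h1, h2, h3⟩ := hst.base_fin
  obtain ⟨x1, x2⟩ := hst.xInt_fin hst.dens₀ hst.payoff₀
  have i1 := hst.dens₀.integrable.const_mul a
  have i2 := x1.const_mul t
  refine ⟨h1.mono fun r hr => ?_, (i1.add i2).sub h2, ?_⟩
  · convert hst.mul_sub_le_conj r (a + t * X r) hr using 2
    ring
  · rw [integral_sub (by exact i1.add i2) h2, integral_add i1 i2, integral_const_mul,
      integral_const_mul, hst.dens₀.integral_eq_one, x2, h3]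
    ring

theorem le_kfun (hst : Standing μ β β' X p₀ b₀) (a t : ℝ) :
    ((a + t * b₀ : ℝ) : EReal) ≤ Kfun μ β X a t := by
  obtain ⟨h1, h2, h3⟩ := hst.base_le_conj a t
  rw [← h3]
  exact integral_le_eInt h1 h2

theorem kfun_eq (hst : Standing μ β β' X p₀ b₀) {a t : ℝ} (h : KFin μ β X a t) :
    Kfun μ β X a t = (KReal μ β X a t : EReal) :=
  eInt_eq_integral (h.1.mono fun r hr => (hst.coe_conj r hr).symm) h.2

theorem kfin_of_ne_top (hst : Standing μ β β' X p₀ b₀) {a t : ℝ} (h : Kfun μ β X a t ≠ ⊤) :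
    KFin μ β X a t := by
  have hm : Measurable (fun r => conjβ β r (a + t * X r)) :=
    hst.measurable_conj ((hst.Xmeas.const_mul t).const_add a)
  have hb : Kfun μ β X a t ≠ ⊥ := fun hb => by
    have := hst.le_kfun a t
    rw [hb, le_bot_iff] at this
    exact EReal.coe_ne_bot _ this
  obtain ⟨h1, h2⟩ := ae_eq_coe_of_eInt hm.aemeasurable h hb
  exact ⟨h1.mono fun r hr => hr ▸ EReal.coe_ne_top _, h2⟩

theorem kfun_eq_top (hst : Standing μ β β' X p₀ b₀) {a t : ℝ} (h : ¬ KFin μ β X a t) :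
    Kfun μ β X a t = ⊤ := by
  by_contra h'
  exact h (hst.kfin_of_ne_top h')

theorem le_kreal (hst : Standing μ β β' X p₀ b₀) {a t : ℝ} (h : KFin μ β X a t) :
    a + t * b₀ ≤ KReal μ β X a t := by
  have := hst.le_kfun a t
  rw [hst.kfun_eq h] at this
  exact_mod_cast this

/-- A real-valued integrable majorant of the conjugate bounds `K`. -/
theorem kfin_of_le (hst : Standing μ β β' X p₀ b₀) {a t c : ℝ} {M : Ω → ℝ}
    (hM : Integrable M μ) (hle : ∀ᵐ r ∂μ, conjβ β r (a + t * X r) ≤ (M r : EReal))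
    (hc : ∫ r, M r ∂μ ≤ c) : KFin μ β X a t ∧ KReal μ β X a t ≤ c := by
  have h1 : Kfun μ β X a t ≤ (c : EReal) :=
    (eInt_le_integral hle hM).trans (by exact_mod_cast hc)
  have h2 : KFin μ β X a t := hst.kfin_of_ne_top (ne_top_of_le_ne_top (EReal.coe_ne_top _) h1)
  refine ⟨h2, ?_⟩
  rw [hst.kfun_eq h2] at h1
  exact_mod_cast h1

theorem kfin_segment (hst : Standing μ β β' X p₀ b₀) {a t a' t' e : ℝ} (he : 0 ≤ e) (he1 : e ≤ 1)
    (h : KFin μ β X a t) (h' : KFin μ β X a' t') :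
    KFin μ β X (a + e * (a' - a)) (t + e * (t' - t)) ∧
      KReal μ β X (a + e * (a' - a)) (t + e * (t' - t)) ≤
        (1 - e) * KReal μ β X a t + e * KReal μ β X a' t' := by
  refine hst.kfin_of_le ((h.2.const_mul (1 - e)).add (h'.2.const_mul e)) ?_ ?_
  · filter_upwards [h.1, h'.1] with r h1 h2
    convert hst.conj_mid_le r he he1 h1 h2 using 2
    · ring
    · rfl
  · change ∫ r, ((1 - e) * _ + e * _) ∂μ ≤ _
    rw [integral_add (h.2.const_mul (1 - e)) (h'.2.const_mul e), integral_const_mul,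
      integral_const_mul]
    rfl

end Standing

theorem exists_integrable_majorant_of_monotone {Ω : Type*} [MeasurableSpace Ω] {μ : Measure Ω}
    {V : ℕ → Ω → ℝ} {c : ℝ} (hV : ∀ n, Integrable (V n) μ) (hmono : ∀ r, Monotone (fun n => V n r))
    (hc : ∀ n, ∫ r, V n r ∂μ ≤ c) :
    ∃ M : Ω → ℝ, Integrable M μ ∧ ∫ r, M r ∂μ ≤ c ∧ ∀ᵐ r ∂μ, ∀ n, V n r ≤ M r := by
  have hInt : ∀ n, Integrable (fun r => V n r - V 0 r) μ := fun n => (hV n).sub (hV 0)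
  have hnn : ∀ n r, 0 ≤ V n r - V 0 r := fun n r => sub_nonneg.2 (hmono r (Nat.zero_le n))
  have hlin : ∫⁻ r, ⨆ n, ENNReal.ofReal (V n r - V 0 r) ∂μ ≠ ⊤ := by
    rw [lintegral_iSup' (fun n => (hInt n).aemeasurable.ennreal_ofReal)
      (ae_of_all _ fun r i j hij => ENNReal.ofReal_le_ofReal
        (sub_le_sub_right (hmono r hij) _))]
    refine ne_top_of_le_ne_top (ENNReal.ofReal_ne_top (r := c - ∫ r, V 0 r ∂μ)) (iSup_le fun n => ?_)
    rw [← ofReal_integral_eq_lintegral_ofReal (hInt n) (ae_of_all _ (hnn n)),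
      integral_sub (hV n) (hV 0)]
    exact ENNReal.ofReal_le_ofReal (by linarith [hc n])
  have hfin := ae_lt_top' (AEMeasurable.iSup
    fun n => (hInt n).aemeasurable.ennreal_ofReal) hlin
  have hbdd : ∀ᵐ r ∂μ, BddAbove (range fun n => V n r) := by
    filter_upwards [hfin] with r hr
    refine ⟨V 0 r + (⨆ n, ENNReal.ofReal (V n r - V 0 r)).toReal, ?_⟩
    rintro _ ⟨n, rfl⟩
    have h1 := ENNReal.toReal_mono hr.ne (le_iSup (fun n => ENNReal.ofReal (V n r - V 0 r)) n)
    rw [ENNReal.toReal_ofReal (hnn n r)] at h1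
    change V n r ≤ _
    linarith
  obtain ⟨h1, h2⟩ := integrable_of_tendsto_of_integral_le (L := fun r => ⨆ n, V n r) hV (hV 0)
    (fun n => ae_of_all _ fun r => hmono r (Nat.zero_le n))
    (hbdd.mono fun r hr => tendsto_atTop_ciSup (hmono r) hr) hc
  exact ⟨_, h1, h2, hbdd.mono fun r hr n => le_ciSup hr n⟩

/-- `q` is a nonnegative function with finite moments and `g` an integrable majorant of
`β(r, q(r))`. -/
def Admissible {Ω : Type*} [MeasurableSpace Ω] (μ : Measure Ω) (β : Ω → ℝ → EReal) (X : Ω → ℝ)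
    (q g : Ω → ℝ) : Prop :=
  Measurable q ∧ (∀ r, 0 ≤ q r) ∧ Integrable q μ ∧ Integrable (fun r => X r * q r) μ ∧
    Integrable g μ ∧ ∀ᵐ r ∂μ, β r (q r) ≤ (g r : EReal)

namespace Standing

variable {Ω : Type*} [MeasurableSpace Ω] {μ : Measure Ω} {β : Ω → ℝ → EReal}
  {β' : Ω → ℝ → ℝ} {ψ : Ω → ℝ → ℝ} {X p₀ : Ω → ℝ} {b₀ : ℝ}

theorem tendsto_beta_add (hst : Standing μ β β' X p₀ b₀) (r : Ω) {s : ℝ} (hs : 0 ≤ s) :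
    Tendsto (fun e => β r (s + e)) (𝓝[>] 0) (𝓝 (β r s)) := by
  rcases hs.eq_or_lt with h | h
  · subst h
    simpa using hst.betaZero r
  · have h1 : ContinuousAt (fun t => (((β r t).toReal : ℝ) : EReal)) s :=
      continuous_coe_real_ereal.continuousAt.comp (hst.betaDeriv r s h).continuousAt
    have h2 : ContinuousAt (β r) s := by
      refine h1.congr ?_
      filter_upwards [Ioi_mem_nhds h] with t ht using hst.coe_beta r ht
    have h3 : Tendsto (fun e : ℝ => s + e) (𝓝 0) (𝓝 s) := by
      have : Tendsto (fun e : ℝ => s + e) (𝓝 0) (𝓝 (s + 0)) := Continuous.tendsto (by fun_prop) 0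
      simpa using this
    exact h2.tendsto.comp (h3.mono_left nhdsWithin_le_nhds)

theorem beta_convex (hst : Standing μ β β' X p₀ b₀) (r : Ω) {s t c d x y : ℝ} (hs : 0 ≤ s)
    (ht : 0 ≤ t) (hc : β r s ≤ (c : EReal)) (hd : β r t ≤ (d : EReal)) (hx : 0 ≤ x) (hy : 0 ≤ y)
    (hxy : x + y = 1) : β r (x * s + y * t) ≤ ((x * c + y * d : ℝ) : EReal) := by
  have hlim : ∀ {s c : ℝ}, 0 ≤ s → β r s ≤ (c : EReal) →
      Tendsto (fun e => (β r (s + e)).toReal) (𝓝[>] 0) (𝓝 (β r s).toReal) ∧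
        (β r s).toReal ≤ c := by
    intro s c hs hc
    have hs' : β r s ≠ ⊤ := ne_top_of_le_ne_top (EReal.coe_ne_top _) hc
    refine ⟨(EReal.tendsto_toReal hs' (hst.betaNeBot r s)).comp (hst.tendsto_beta_add r hs), ?_⟩
    simpa using EReal.toReal_le_toReal hc (hst.betaNeBot r s) (EReal.coe_ne_top _)
  obtain ⟨l1, c1⟩ := hlim hs hc
  obtain ⟨l2, d1⟩ := hlim ht hd
  have hR : Tendsto (fun e => ((x * (β r (s + e)).toReal + y * (β r (t + e)).toReal : ℝ) : EReal))
      (𝓝[>] 0) (𝓝 ((x * (β r s).toReal + y * (β r t).toReal : ℝ) : EReal)) :=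
    EReal.tendsto_coe.2 ((l1.const_mul x).add (l2.const_mul y))
  have hL := hst.tendsto_beta_add r (s := x * s + y * t) (by positivity)
  refine (le_of_tendsto_of_tendsto hL hR ?_).trans ?_
  · filter_upwards [self_mem_nhdsWithin] with e he
    have he : 0 < e := he
    have h := (hst.betaConv r).convexOn.2 (mem_Ioi.2 (by positivity : 0 < s + e))
      (mem_Ioi.2 (by positivity : 0 < t + e)) hx hy hxy
    simp only [smul_eq_mul] at h
    have heq : x * (s + e) + y * (t + e) = x * s + y * t + e := by
      calc x * (s + e) + y * (t + e) = x * s + y * t + (x + y) * e := by ring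
        _ = _ := by rw [hxy, one_mul]
    rw [heq] at h
    rw [← hst.coe_beta r (s := x * s + y * t + e) (by positivity)]
    exact_mod_cast h
  · exact_mod_cast add_le_add (mul_le_mul_of_nonneg_left c1 hx) (mul_le_mul_of_nonneg_left d1 hy)

theorem exists_step (hst : Standing μ β β' X p₀ b₀) {q : Ω → ℝ} (u w z : ℝ)
    (hq : Admissible μ β X q (fun r => (β r (q r)).toReal)) {s : ℝ} (hs : 0 < s) {E : Set Ω}
    (hE : MeasurableSet E) (hμE : μ E < ⊤) {N : ℝ} (hX : ∀ r ∈ E, |X r| ≤ N)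
    (hβ : ∀ r ∈ E, |(β r s).toReal| ≤ N) :
    ∃ q' : Ω → ℝ, Admissible μ β X q' (fun r => (β r (q' r)).toReal) ∧
      (∀ r, q r * (u + w * X r) + z * (β r (q r)).toReal ≤
        q' r * (u + w * X r) + z * (β r (q' r)).toReal) ∧
      ∀ r ∈ E, s * (u + w * X r) + z * (β r s).toReal ≤
        q' r * (u + w * X r) + z * (β r (q' r)).toReal := by
  classical
  obtain ⟨h1, h2, h3, h4, h5, h6⟩ := hq
  have hXm := hst.Xmeas
  have hm1 : Measurable (fun r => q r * (u + w * X r) + z * (β r (q r)).toReal) :=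
    (h1.mul ((hXm.const_mul w).const_add u)).add
      ((hst.measurable_beta_comp h1 h2).ereal_toReal.const_mul z)
  have hm2 : Measurable (fun r => s * (u + w * X r) + z * (β r s).toReal) :=
    (((hXm.const_mul w).const_add u).const_mul s).add
      ((hst.betaMeas s).ereal_toReal.const_mul z)
  set A : Set Ω := E ∩ {r | q r * (u + w * X r) + z * (β r (q r)).toReal <
    s * (u + w * X r) + z * (β r s).toReal}
  have hA : MeasurableSet A := hE.inter (measurableSet_lt hm1 hm2)
  have hμA : μ A < ⊤ := (measure_mono inter_subset_left).trans_lt hμE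
  have hbd : ∀ f : Ω → ℝ, Measurable f → (∀ r ∈ E, |f r| ≤ N) → IntegrableOn f A μ := by
    intro f hf hb
    refine IntegrableOn.of_bound hμA hf.aestronglyMeasurable N ?_
    exact (ae_restrict_iff' hA).2 (ae_of_all _ fun r hr => hb r hr.1)
  set q' : Ω → ℝ := A.piecewise (fun _ => s) q with hq'
  have hin : ∀ r ∈ A, q' r = s := fun r hr => Set.piecewise_eq_of_mem _ _ _ hr
  have hout : ∀ r ∉ A, q' r = q r := fun r hr => Set.piecewise_eq_of_notMem _ _ _ hr
  refine ⟨q', ⟨measurable_const.piecewise hA h1, fun r => ?_, ?_, ?_, ?_, ?_⟩, fun r => ?_,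
    fun r hr => ?_⟩
  · by_cases hr : r ∈ A
    · rw [hin r hr]; exact hs.le
    · rw [hout r hr]; exact h2 r
  · exact Integrable.piecewise hA (integrableOn_const hμA.ne) h3.integrableOn
  · have : (fun r => X r * q' r) = A.piecewise (fun r => X r * s) (fun r => X r * q r) := by
      funext r
      by_cases hr : r ∈ A
      · rw [hin r hr, Set.piecewise_eq_of_mem _ _ _ hr]
      · rw [hout r hr, Set.piecewise_eq_of_notMem _ _ _ hr]
    rw [this]
    exact Integrable.piecewise hA ((hbd X hXm hX).mul_const s) h4.integrableOn
  · have : (fun r => (β r (q' r)).toReal) =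
        A.piecewise (fun r => (β r s).toReal) (fun r => (β r (q r)).toReal) := by
      funext r
      by_cases hr : r ∈ A
      · rw [hin r hr, Set.piecewise_eq_of_mem _ _ _ hr]
      · rw [hout r hr, Set.piecewise_eq_of_notMem _ _ _ hr]
    rw [this]
    exact Integrable.piecewise hA (hbd _ (hst.betaMeas s).ereal_toReal hβ) h5.integrableOn
  · filter_upwards [h6] with r hr6
    by_cases hr : r ∈ A
    · rw [hin r hr, hst.coe_beta r hs]
    · rw [hout r hr]; exact hr6
  · by_cases hr : r ∈ A
    · rw [hin r hr]; exact hr.2.le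
    · rw [hout r hr]
  · by_cases hr' : r ∈ A
    · rw [hin r hr']
    · rw [hout r hr']
      by_contra hlt
      exact hr' ⟨hr, not_le.1 hlt⟩

theorem admissible_base (hst : Standing μ β β' X p₀ b₀) :
    Admissible μ β X p₀ (fun r => (β r (p₀ r)).toReal) :=
  ⟨hst.dens₀.1, hst.dens₀.2.1, hst.dens₀.integrable, (hst.xInt_fin hst.dens₀ hst.payoff₀).1,
    hst.base_fin.2.1, hst.base_fin.1.mono fun r hr =>
      (EReal.coe_toReal hr (hst.betaNeBot r _)).ge⟩

/-- Interchange of integration and pointwise supremum: a bound for the integral functional over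
all admissible pairs yields an integrable pointwise majorant obeying the same bound. -/
theorem exists_majorant (hst : Standing μ β β' X p₀ b₀) {u w z c : ℝ}
    (h : ∀ q g, Admissible μ β X q g →
      u * ∫ r, q r ∂μ + w * ∫ r, X r * q r ∂μ + z * ∫ r, g r ∂μ ≤ c) :
    ∃ M : Ω → ℝ, Integrable M μ ∧ ∫ r, M r ∂μ ≤ c ∧
      ∀ᵐ r ∂μ, ∀ s, 0 < s → s * (u + w * X r) + z * (β r s).toReal ≤ M r := by
  have := hst.sigma
  have : Nonempty {s : ℚ // 0 < s} := ⟨⟨1, one_pos⟩⟩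
  obtain ⟨e, he⟩ := exists_surjective_nat ({s : ℚ // 0 < s} × ℕ)
  set E : ℕ → Set Ω := fun n => spanningSets μ (e n).2 ∩ ({r | |X r| ≤ (e n).2} ∩
    {r | |(β r ((e n).1 : ℚ)).toReal| ≤ (e n).2}) with hE
  have hEm : ∀ n, MeasurableSet (E n) := fun n =>
    (measurableSet_spanningSets μ _).inter
      ((measurableSet_le hst.Xmeas.abs measurable_const).inter
        (measurableSet_le (hst.betaMeas _).ereal_toReal.abs measurable_const))
  have hstep : ∀ (n : ℕ) (q : {q : Ω → ℝ // Admissible μ β X q (fun r => (β r (q r)).toReal)}),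
      ∃ q' : {q : Ω → ℝ // Admissible μ β X q (fun r => (β r (q r)).toReal)},
      (∀ r, q.1 r * (u + w * X r) + z * (β r (q.1 r)).toReal ≤
        q'.1 r * (u + w * X r) + z * (β r (q'.1 r)).toReal) ∧
      ∀ r ∈ E n, ((e n).1 : ℚ) * (u + w * X r) + z * (β r ((e n).1 : ℚ)).toReal ≤
        q'.1 r * (u + w * X r) + z * (β r (q'.1 r)).toReal := by
    intro n q
    obtain ⟨q', h1, h2⟩ := hst.exists_step u w z q.2 (s := ((e n).1 : ℚ))
      (by exact_mod_cast (e n).1.2) (hEm n)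
      ((measure_mono inter_subset_left).trans_lt (measure_spanningSets_lt_top μ (e n).2))
      (N := (e n).2) (fun r hr => hr.2.1) (fun r hr => hr.2.2)
    exact ⟨⟨q', h1⟩, h2⟩
  choose F hF1 hF2 using hstep
  let Q : ℕ → {q : Ω → ℝ // Admissible μ β X q (fun r => (β r (q r)).toReal)} :=
    fun n => Nat.rec ⟨p₀, hst.admissible_base⟩ (fun n q => F n q) n
  have hQ : ∀ n, Q (n + 1) = F n (Q n) := fun n => rfl
  set V : ℕ → Ω → ℝ := fun n r =>
    (Q n).1 r * (u + w * X r) + z * (β r ((Q n).1 r)).toReal with hV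
  have hVeq : ∀ n, V n = fun r => u * (Q n).1 r + w * (X r * (Q n).1 r) +
      z * (β r ((Q n).1 r)).toReal := by
    intro n; funext r; simp only [hV]; ring
  have hVi : ∀ n, Integrable (V n) μ := by
    intro n
    obtain ⟨-, -, h3, h4, h5, -⟩ := (Q n).2
    rw [hVeq]
    exact ((h3.const_mul u).add (h4.const_mul w)).add (h5.const_mul z)
  have hVc : ∀ n, ∫ r, V n r ∂μ ≤ c := by
    intro n
    obtain ⟨-, -, h3, h4, h5, -⟩ := (Q n).2
    rw [hVeq]
    rw [integral_add (by exact (h3.const_mul u).add (h4.const_mul w)) (h5.const_mul z),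
      integral_add (h3.const_mul u) (h4.const_mul w), integral_const_mul, integral_const_mul,
      integral_const_mul]
    exact h _ _ (Q n).2
  have hVm : ∀ r, Monotone (fun n => V n r) := fun r =>
    monotone_nat_of_le_succ fun n => by
      have := hF1 n (Q n) r
      rwa [← hQ n] at this
  obtain ⟨M, hM1, hM2, hM3⟩ := exists_integrable_majorant_of_monotone hVi hVm hVc
  refine ⟨M, hM1, hM2, hM3.mono fun r hr s hs => hst.le_of_forall_rat r (fun q hq => ?_) hs⟩
  obtain ⟨m₁, hm₁⟩ := exists_nat_ge |X r|
  obtain ⟨m₂, hm₂⟩ := exists_nat_ge |(β r q).toReal|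
  obtain ⟨m₃, hm₃⟩ := mem_iUnion.1 ((iUnion_spanningSets μ).symm ▸ mem_univ r)
  set m := max m₁ (max m₂ m₃)
  obtain ⟨n, hn⟩ := he (⟨q, hq⟩, m)
  have hrE : r ∈ E n := by
    simp only [hE, hn]
    refine ⟨monotone_spanningSets μ (by simp [m] : m₃ ≤ m) hm₃,
      hm₁.trans ?_, hm₂.trans ?_⟩
    · exact_mod_cast (by simp [m] : m₁ ≤ m)
    · exact_mod_cast (by simp [m] : m₂ ≤ m)
  have h1 := hF2 n (Q n) r hrE
  rw [← hQ n, hn] at h1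
  exact h1.trans (hr (n + 1))

theorem ae_neBot (hst : Standing μ β β' X p₀ b₀) : (ae μ).NeBot := by
  refine MeasureTheory.ae_neBot.2 fun h => ?_
  have := hst.dens₀.2.2
  simp [h] at this

/-- The attainable triples `(∫ q, ∫ X q, h)` with `H(q) ≤ h`. -/
def attainable (μ : Measure Ω) (β : Ω → ℝ → EReal) (X : Ω → ℝ) : Set (ℝ × ℝ × ℝ) :=
  {y | ∃ q g, Admissible μ β X q g ∧ y = (∫ r, q r ∂μ, ∫ r, X r * q r ∂μ, ∫ r, g r ∂μ)}

theorem convex_attainable (hst : Standing μ β β' X p₀ b₀) : Convex ℝ (attainable μ β X) := by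
  rintro _ ⟨q, g, ⟨h1, h2, h3, h4, h5, h6⟩, rfl⟩ _ ⟨q', g', ⟨k1, k2, k3, k4, k5, k6⟩, rfl⟩
    x y hx hy hxy
  have heq : (fun r => X r * (x * q r + y * q' r)) =
      fun r => x * (X r * q r) + y * (X r * q' r) := by funext r; ring
  refine ⟨fun r => x * q r + y * q' r, fun r => x * g r + y * g' r,
    ⟨(h1.const_mul x).add (k1.const_mul y), fun r => ?_, (h3.const_mul x).add (k3.const_mul y), ?_,
      (h5.const_mul x).add (k5.const_mul y), ?_⟩, ?_⟩
  · have := h2 r; have := k2 r; positivity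
  · rw [heq]; exact (h4.const_mul x).add (k4.const_mul y)
  · filter_upwards [h6, k6] with r hr kr
    exact hst.beta_convex r (h2 r) (k2 r) hr kr hx hy hxy
  · rw [heq, integral_add (h3.const_mul x) (k3.const_mul y),
      integral_add (h4.const_mul x) (k4.const_mul y),
      integral_add (h5.const_mul x) (k5.const_mul y)]
    simp only [integral_const_mul]
    rfl

/-- Lagrange duality: if no density with expected payoff `b` has `H ≤ f`, there is a multiplier
pair certifying this through `K`. -/
theorem exists_dual (hst : Standing μ β β' X p₀ b₀) {b f : ℝ} (hm : essInfX μ X < (b : EReal))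
    (hM : (b : EReal) < essSupX μ X)
    (hno : ∀ q, IsDensity μ q → xInt μ X q = (b : EReal) → ¬ Hfun μ β q ≤ (f : EReal)) :
    ∃ u w, KFin μ β X u w ∧ KReal μ β X u w ≤ u + w * b - f := by
  have hnot : ((1 : ℝ), b, f) ∉ attainable μ β X := by
    rintro ⟨q, g, ⟨h1, h2, h3, h4, h5, h6⟩, heq⟩
    simp only [Prod.mk.injEq] at heq
    refine hno q (isDensity_of_integral_eq_one h1 h2 h3 heq.1.symm) ?_ ?_
    · rw [xInt_eq_integral h4, ← heq.2.1]
    · rw [heq.2.2]; exact eInt_le_integral h6 h5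
  obtain ⟨L, hL0, hL⟩ := hst.convex_attainable.exists_ne_zero_forall_le_of_notMem
    ⟨_, _, _, hst.admissible_base, rfl⟩ hnot
  set u := L (1, 0, 0) with hu
  set w := L (0, 1, 0) with hw
  set z := L (0, 0, 1) with hz
  have hLf : ∀ x y t : ℝ, L (x, y, t) = u * x + w * y + z * t := by
    intro x y t
    have : ((x, y, t) : ℝ × ℝ × ℝ) =
        x • ((1 : ℝ), (0 : ℝ), (0 : ℝ)) + y • ((0 : ℝ), (1 : ℝ), (0 : ℝ)) +
        t • ((0 : ℝ), (0 : ℝ), (1 : ℝ)) := by simp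
    rw [this, map_add, map_add, map_smul, map_smul, map_smul]
    simp only [smul_eq_mul, ← hu, ← hw, ← hz]; ring
  have hadm : ∀ q g, Admissible μ β X q g →
      u * ∫ r, q r ∂μ + w * ∫ r, X r * q r ∂μ + z * ∫ r, g r ∂μ ≤ u + w * b + z * f := by
    intro q g hq
    have := hL _ ⟨q, g, hq, rfl⟩
    rwa [hLf, hLf, mul_one] at this
  obtain ⟨m1, m2, m3, m4, m5, m6⟩ := hst.admissible_base
  have hz0 : z ≤ 0 := by
    by_contra hpos
    push Not at hpos
    obtain ⟨n, hn⟩ := exists_nat_gt ((u + w * b + z * f - (u + w * b₀)) / z)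
    have h1 := hadm p₀ (fun r => (β r (p₀ r)).toReal + n * p₀ r)
      ⟨m1, m2, m3, m4, m5.add (m3.const_mul _), m6.mono fun r hr => hr.trans ?_⟩
    · rw [integral_add m5 (m3.const_mul _), integral_const_mul, hst.dens₀.integral_eq_one,
        (hst.xInt_fin hst.dens₀ hst.payoff₀).2, hst.base_fin.2.2] at h1
      rw [div_lt_iff₀ hpos] at hn
      linarith
    · have := mul_nonneg (Nat.cast_nonneg (α := ℝ) n) (m2 r)
      exact_mod_cast (by linarith)
  obtain ⟨M, hM1, hM2, hM3⟩ := hst.exists_majorant hadm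
  have hne := hst.ae_neBot
  rcases hz0.eq_or_lt with h0 | hneg
  · exfalso
    have hsign : ∀ᵐ r ∂μ, u + w * X r ≤ 0 ∧ 0 ≤ M r := by
      filter_upwards [hM3] with r hr
      simp only [h0, zero_mul, add_zero] at hr
      constructor
      · by_contra hp
        push Not at hp
        have h1 := hr ((|M r| + 1) / (u + w * X r)) (by positivity)
        rw [div_mul_cancel₀ _ hp.ne'] at h1
        linarith [le_abs_self (M r)]
      · have hl : Tendsto (fun s : ℝ => s * (u + w * X r)) (𝓝[>] 0) (𝓝 0) := by
          have : Tendsto (fun s : ℝ => s * (u + w * X r)) (𝓝 0) (𝓝 (0 * (u + w * X r))) :=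
            Continuous.tendsto (by fun_prop) 0
          rw [zero_mul] at this
          exact this.mono_left nhdsWithin_le_nhds
        refine le_of_tendsto hl ?_
        filter_upwards [self_mem_nhdsWithin] with s hs using hr s hs
    have hMn : 0 ≤ u + w * b := by
      have := integral_nonneg_of_ae (hsign.mono fun r hr => hr.2)
      rw [h0] at hM2
      linarith
    rcases lt_trichotomy w 0 with hw0 | hw0 | hw0
    · refine absurd hm (not_lt.2 (le_essInf_of_ae_le _ ?_))
      filter_upwards [hsign] with r hr
      have : b ≤ X r := by nlinarith [hr.1]
      exact_mod_cast this
    · obtain ⟨r, hr⟩ := hsign.exists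
      have hu0 : u = 0 := by
        have := hr.1
        rw [hw0] at this hMn
        linarith
      apply hL0
      refine ContinuousLinearMap.ext fun y => ?_
      rw [show y = (y.1, y.2.1, y.2.2) from rfl, hLf, hu0, hw0, h0]
      simp
    · refine absurd hM (not_lt.2 (essSup_le_of_ae_le _ ?_))
      filter_upwards [hsign] with r hr
      have : X r ≤ b := by nlinarith [hr.1]
      exact_mod_cast this
  · have hz' : 0 < -z := by linarith
    have hzne : z ≠ 0 := hneg.ne
    have hres := hst.kfin_of_le (a := u / (-z)) (t := w / (-z)) (c := u / -z + w / -z * b - f)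
      (M := fun r => M r / (-z)) (hM1.div_const _) ?_ ?_
    · exact ⟨_, _, hres⟩
    · filter_upwards [hM3] with r hr
      rw [hst.conj_le_iff]
      intro s hs
      rw [le_div_iff₀ hz']
      have h1 := hr s hs
      have : (s * (u / -z + w / -z * X r) - (β r s).toReal) * -z =
          s * (u + w * X r) + z * (β r s).toReal := by field_simp; ring
      rw [this]; exact h1
    · rw [integral_div, div_le_iff₀ hz']
      have : (u / -z + w / -z * b - f) * -z = u + w * b + z * f := by field_simp; ring
      rw [this]; exact hM2

end Standing

/-- The pair `(θ₁, θ₂)` maximises `(k + K − θ₁)/θ₂` over `θ₂ < 0`, with finite maximum `v`. -/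
def IsMaximizer {Ω : Type*} [MeasurableSpace Ω] (μ : Measure Ω) (β : Ω → ℝ → EReal) (X : Ω → ℝ)
    (k v θ₁ θ₂ : ℝ) : Prop :=
  θ₂ < 0 ∧ KFin μ β X θ₁ θ₂ ∧ KReal μ β X θ₁ θ₂ - θ₁ + k = v * θ₂ ∧
    ∀ a t, t < 0 → KFin μ β X a t → v * t ≤ KReal μ β X a t - a + k

theorem IsMaximizer.value_unique {Ω : Type*} [MeasurableSpace Ω] {μ : Measure Ω}
    {β : Ω → ℝ → EReal} {X : Ω → ℝ} {k v v' a t a' t' : ℝ} (h : IsMaximizer μ β X k v a t)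
    (h' : IsMaximizer μ β X k v' a' t') : v = v' := by
  obtain ⟨h1, h2, h3, h4⟩ := h
  obtain ⟨k1, k2, k3, k4⟩ := h'
  have e1 := h4 _ _ k1 k2
  have e2 := k4 _ _ h1 h2
  rw [h3] at e2
  rw [k3] at e1
  exact le_antisymm ((mul_le_mul_right_of_neg h1).1 e2) ((mul_le_mul_right_of_neg k1).1 e1)

namespace Standing

variable {Ω : Type*} [MeasurableSpace Ω] {μ : Measure Ω} {β : Ω → ℝ → EReal}
  {β' : Ω → ℝ → ℝ} {ψ : Ω → ℝ → ℝ} {X p₀ : Ω → ℝ} {b₀ : ℝ}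

theorem quotient_eq (hst : Standing μ β β' X p₀ b₀) (k : ℝ) {a t : ℝ} (h : KFin μ β X a t) :
    ((k : EReal) + Kfun μ β X a t - (a : EReal)) / (t : EReal) =
      (((k + KReal μ β X a t - a) / t : ℝ) : EReal) := by
  rw [hst.kfun_eq h, EReal.coe_div, EReal.coe_sub, EReal.coe_add]

theorem quotient_eq_bot (hst : Standing μ β β' X p₀ b₀) (k : ℝ) {a t : ℝ}
    (h : ¬ KFin μ β X a t) (ht : t < 0) :
    ((k : EReal) + Kfun μ β X a t - (a : EReal)) / (t : EReal) = ⊥ := by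
  rw [hst.kfun_eq_top h, EReal.coe_add_top, EReal.top_sub_coe]
  exact EReal.top_div_of_neg_ne_bot (by exact_mod_cast ht) (EReal.coe_ne_bot _)

theorem exists_isMaximizer (hst : Standing μ β β' X p₀ b₀) {k θ₁ θ₂ u w : ℝ}
    (h : IsWCLParam μ β X k θ₁ θ₂) (hw : w < 0) (huw : KFin μ β X u w) :
    ∃ v, IsMaximizer μ β X k v θ₁ θ₂ := by
  obtain ⟨h1, h2⟩ := h
  have h3 : KFin μ β X θ₁ θ₂ := by
    by_contra hno
    have := h2 u w hw
    rw [hst.quotient_eq_bot k hno h1, hst.quotient_eq k huw, le_bot_iff] at this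
    exact EReal.coe_ne_bot _ this
  refine ⟨(k + KReal μ β X θ₁ θ₂ - θ₁) / θ₂, h1, h3, ?_, fun a t ht hat => ?_⟩
  · rw [div_mul_cancel₀ _ h1.ne]; ring
  · have := h2 a t ht
    rw [hst.quotient_eq k hat, hst.quotient_eq k h3] at this
    have : (k + KReal μ β X a t - a) / t ≤ (k + KReal μ β X θ₁ θ₂ - θ₁) / θ₂ := by
      exact_mod_cast this
    rw [div_le_iff_of_neg ht] at this
    linarith

theorem exists_kfin_neg (hst : Standing μ β β' X p₀ b₀) {k : ℝ} (hk0 : 0 < k)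
    (hkmax : (k : EReal) < kmax μ β X b₀) :
    ∃ b : ℝ, essInfX μ X < (b : EReal) ∧
      ∃ u w, w < 0 ∧ KFin μ β X u w ∧ ∃ k', k < k' ∧ KReal μ β X u w ≤ u + w * b - k' := by
  obtain ⟨⟨b, hb1, hb2⟩, hlt⟩ := lt_iSup_iff.1 hkmax
  obtain ⟨k', hk1, hk2⟩ := EReal.lt_iff_exists_real_btwn.1 hlt
  have hk1 : k < k' := by exact_mod_cast hk1
  obtain ⟨u, w, h1, h2⟩ := hst.exists_dual (f := k') hb1
    ((by exact_mod_cast hb2 : (b : EReal) < b₀).trans hst.ltM) (by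
      intro q hq hqb hle
      exact absurd (hk2.trans_le (iInf_le_of_le ⟨q, hq, hqb⟩ hle)) (lt_irrefl _))
  have := hst.le_kreal h1
  refine ⟨b, hb1, u, w, ?_, h1, k', hk1, h2⟩
  by_contra hw
  push Not at hw
  nlinarith

theorem exists_kfin_right (hst : Standing μ β β' X p₀ b₀) {t : ℝ} (ht : t < 0) :
    ∃ u w, t < w ∧ KFin μ β X u w := by
  obtain ⟨b, hb1, hb2⟩ := EReal.lt_iff_exists_real_btwn.1 hst.ltM
  have hb1 : b₀ < b := by exact_mod_cast hb1
  have hpos : 0 < (b - b₀) * (-t) := mul_pos (by linarith) (by linarith)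
  obtain ⟨u, w, h1, h2⟩ := hst.exists_dual (f := -((b - b₀) * (-t) / 2))
    (hst.mlt.trans (by exact_mod_cast hb1)) hb2 (by
      intro q hq _ hle
      have := (hst.Hnonneg q hq).trans hle
      have : 0 ≤ -((b - b₀) * (-t) / 2) := by exact_mod_cast this
      linarith)
  have := hst.le_kreal h1
  refine ⟨u, w, ?_, h1⟩
  by_contra hw
  push Not at hw
  nlinarith

theorem kfin_sub (hst : Standing μ β β' X p₀ b₀) {a t e : ℝ} (he : 0 ≤ e)
    (h : KFin μ β X a t) : KFin μ β X (a - e) t := by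
  refine (hst.kfin_of_le h.2 ?_ le_rfl).1
  filter_upwards [h.1] with r hr
  rw [hst.coe_conj r hr, show a - e + t * X r = a + t * X r - e by ring]
  exact hst.conj_sub_mono r he hr

/-- At a minimiser of `θ₁ ↦ K(θ₁, θ₂) − θ₁` the argument of the conjugate stays strictly below
`β'(r, +∞)`. -/
theorem ae_lt_derivTop (hst : Standing μ β β' X p₀ b₀) {a t : ℝ} (h : KFin μ β X a t)
    (hmin : ∀ a', KFin μ β X a' t → KReal μ β X a t - a ≤ KReal μ β X a' t - a') :
    ∀ᵐ r ∂μ, ((a + t * X r : ℝ) : EReal) < derivTop β' r := by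
  set e : ℕ → ℝ := fun n => 1 / ((n : ℝ) + 1) with he
  have hepos : ∀ n, 0 < e n := fun n => by simp only [he]; positivity
  set V : ℕ → Ω → ℝ := fun n r => ((conjβ β r (a + t * X r)).toReal -
    (conjβ β r (a - e n + t * X r)).toReal) / e n with hV
  have hVi : ∀ n, Integrable (V n) μ := fun n =>
    (h.2.sub (hst.kfin_sub (hepos n).le h).2).div_const _
  have hVm : ∀ n, Measurable (V n) := fun n =>
    ((hst.measurable_conj ((hst.Xmeas.const_mul t).const_add a)).ereal_toReal.sub
      (hst.measurable_conj ((hst.Xmeas.const_mul t).const_add _)).ereal_toReal).div_const _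
  have hVc : ∀ n, ∫ r, V n r ∂μ ≤ 1 := by
    intro n
    have h1 := hst.kfin_sub (hepos n).le h
    have h2 := hmin _ h1
    simp only [hV]
    rw [integral_div, integral_sub h.2 h1.2, div_le_one (hepos n)]
    simp only [KReal] at h2
    linarith
  have hV0 : ∀ n, 0 ≤ᵐ[μ] V n := by
    intro n
    filter_upwards [h.1] with r hr
    have := hst.conj_sub_mono r (hepos n).le hr
    refine div_nonneg (sub_nonneg.2 ?_) (hepos n).le
    rw [show a - e n + t * X r = a + t * X r - e n by ring]
    exact EReal.toReal_le_toReal this (hst.conj_ne_bot _ _) hr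
  have hfat : ∫⁻ r, liminf (fun n => ENNReal.ofReal (V n r)) atTop ∂μ ≠ ⊤ := by
    refine ne_top_of_le_ne_top ENNReal.one_ne_top
      ((lintegral_liminf_le' fun n => (hVi n).aemeasurable.ennreal_ofReal).trans ?_)
    refine liminf_le_of_frequently_le' (Frequently.of_forall fun n => ?_)
    rw [← ofReal_integral_eq_lintegral_ofReal (hVi n) (hV0 n)]
    exact ENNReal.ofReal_le_one.2 (hVc n)
  have hfin := ae_lt_top (Measurable.liminf fun n => (hVm n).ennreal_ofReal) hfat
  filter_upwards [hfin, h.1] with r hr hr1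
  by_contra hno
  push Not at hno
  refine hr.ne (ENNReal.eq_top_of_forall_nnreal_le fun s => ?_)
  refine le_liminf_of_le (by isBoundedDefault) ?_
  have hs : (0 : ℝ) < s + 1 := by positivity
  have h1 : β' r (s + 1) < a + t * X r := by
    have h2 : ((β' r (s + 1 + 1) : ℝ) : EReal) ≤ derivTop β' r :=
      le_iSup (fun s : {s : ℝ // 0 < s} => (β' r s.1 : EReal)) ⟨s + 1 + 1, by positivity⟩
    have h3 : β' r (s + 1 + 1) ≤ a + t * X r := by exact_mod_cast h2.trans hno
    exact (hst.deriv_lt_deriv r hs (by linarith)).trans_le h3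
  have h4 : ∀ᶠ n in atTop, e n < a + t * X r - β' r (s + 1) :=
    tendsto_one_div_add_atTop_nhds_zero_nat.eventually (Iio_mem_nhds (by linarith))
  filter_upwards [h4] with n hn
  have h5 := hst.conj_sub_le r (hepos n).le hs hr1 (by linarith : β' r (s + 1) ≤ _ - e n)
  rw [ENNReal.le_ofReal_iff_toReal_le ENNReal.coe_ne_top, ENNReal.coe_toReal]
  · simp only [hV]
    rw [le_div_iff₀ (hepos n), show a - e n + t * X r = a + t * X r - e n by ring]
    nlinarith [hepos n]
  · simp only [hV]
    rw [show a - e n + t * X r = a + t * X r - e n by ring]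
    exact div_nonneg (by nlinarith [hepos n]) (hepos n).le

end Standing

namespace Standing

variable {Ω : Type*} [MeasurableSpace Ω] {μ : Measure Ω} {β : Ω → ℝ → EReal}
  {β' : Ω → ℝ → ℝ} {ψ : Ω → ℝ → ℝ} {X p₀ : Ω → ℝ} {b₀ : ℝ}

theorem gfun_le (hst : Standing μ β β' X p₀ b₀) {a t : ℝ} (h : KFin μ β X a t) :
    Gfun μ β X t ≤ ((KReal μ β X a t - a : ℝ) : EReal) := by
  refine (iInf_le _ a).trans ?_
  rw [hst.kfun_eq h, EReal.coe_sub]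

theorem mem_theta2_iff (hst : Standing μ β β' X p₀ b₀) {t : ℝ} :
    t ∈ Theta2 μ β X ↔ ∃ a, KFin μ β X a t := by
  refine ⟨fun h => ?_, fun ⟨a, ha⟩ => (hst.gfun_le ha).trans_lt (EReal.coe_lt_top _)⟩
  have h : (⨅ a : ℝ, (Kfun μ β X a t - (a : EReal))) < ⊤ := h
  obtain ⟨a, ha⟩ := iInf_lt_iff.1 h
  refine ⟨a, hst.kfin_of_ne_top fun h' => ?_⟩
  rw [h', EReal.top_sub_coe] at ha
  exact lt_irrefl _ ha

theorem le_gfun (hst : Standing μ β β' X p₀ b₀) {t c : ℝ}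
    (h : ∀ a, KFin μ β X a t → c ≤ KReal μ β X a t - a) : (c : EReal) ≤ Gfun μ β X t := by
  refine le_iInf fun a => ?_
  by_cases ha : KFin μ β X a t
  · rw [hst.kfun_eq ha, ← EReal.coe_sub]
    exact_mod_cast h a ha
  · rw [hst.kfun_eq_top ha, EReal.top_sub_coe]
    exact le_top

theorem coe_gfun (hst : Standing μ β β' X p₀ b₀) {a t : ℝ} (h : KFin μ β X a t) :
    ((Gfun μ β X t).toReal : EReal) = Gfun μ β X t := by
  refine EReal.coe_toReal ?_ ?_
  · exact ne_top_of_le_ne_top (EReal.coe_ne_top _) (hst.gfun_le h)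
  · refine ne_bot_of_le_ne_bot (EReal.coe_ne_bot (t * b₀)) (hst.le_gfun fun a ha => ?_)
    linarith [hst.le_kreal ha]

theorem gfun_toReal_le (hst : Standing μ β β' X p₀ b₀) {a t : ℝ} (h : KFin μ β X a t) :
    (Gfun μ β X t).toReal ≤ KReal μ β X a t - a := by
  have := hst.gfun_le h
  rw [← hst.coe_gfun h] at this
  exact_mod_cast this

theorem le_gfun_toReal (hst : Standing μ β β' X p₀ b₀) {a t c : ℝ} (h : KFin μ β X a t)
    (hc : ∀ a, KFin μ β X a t → c ≤ KReal μ β X a t - a) : c ≤ (Gfun μ β X t).toReal := by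
  have := hst.le_gfun hc
  rw [← hst.coe_gfun h] at this
  exact_mod_cast this

theorem isMaximizer_ae_lt (hst : Standing μ β β' X p₀ b₀) {k v a t : ℝ}
    (h : IsMaximizer μ β X k v a t) :
    ∀ᵐ r ∂μ, ((a + t * X r : ℝ) : EReal) < derivTop β' r := by
  obtain ⟨h1, h2, h3, h4⟩ := h
  refine hst.ae_lt_derivTop h2 fun a' ha' => ?_
  linarith [h4 a' t h1 ha']

theorem gfun_toReal_eq (hst : Standing μ β β' X p₀ b₀) {k v a t : ℝ}
    (h : IsMaximizer μ β X k v a t) : (Gfun μ β X t).toReal = KReal μ β X a t - a := by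
  obtain ⟨h1, h2, h3, h4⟩ := h
  refine le_antisymm (hst.gfun_toReal_le h2) (hst.le_gfun_toReal h2 fun a' ha' => ?_)
  linarith [h4 a' t h1 ha']

theorem exists_lower_bound (hst : Standing μ β β' X p₀ b₀) {k v θ₁ θ₂ : ℝ}
    (h : IsMaximizer μ β X k v θ₁ θ₂) {q : Ω → ℝ} (hq : IsDensity μ q)
    (hH : Hfun μ β q ≤ (k : EReal)) :
    ∃ B : Ω → ℝ, (∀ r, θ₂ * B r = (conjβ β r (θ₁ + θ₂ * X r)).toReal + (β r (q r)).toReal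
        - θ₁ * q r) ∧ Integrable B μ ∧ v ≤ ∫ r, B r ∂μ ∧ ∀ᵐ r ∂μ, B r ≤ X r * q r := by
  obtain ⟨h1, h2, h3, h4⟩ := h
  obtain ⟨q1, q2, q3⟩ := hst.hfun_fin hq (ne_top_of_le_ne_top (EReal.coe_ne_top _) hH)
  rw [q3] at hH
  have hH : ∫ r, (β r (q r)).toReal ∂μ ≤ k := by exact_mod_cast hH
  have hi := (h2.2.add q2).sub (hq.integrable.const_mul θ₁)
  refine ⟨fun r => ((conjβ β r (θ₁ + θ₂ * X r)).toReal + (β r (q r)).toReal - θ₁ * q r) / θ₂,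
    fun r => mul_div_cancel₀ _ h1.ne, hi.div_const _, ?_, ?_⟩
  · rw [integral_div, le_div_iff_of_neg h1,
      integral_sub (by exact h2.2.add q2) (hq.integrable.const_mul θ₁), integral_add h2.2 q2,
      integral_const_mul, hq.integral_eq_one]
    simp only [KReal] at h3
    linarith
  · filter_upwards [h2.1, q1] with r hr qr
    rw [div_le_iff_of_neg h1]
    linarith [hst.young r qr hr]

theorem le_xInt_of_isMaximizer (hst : Standing μ β β' X p₀ b₀) {k v θ₁ θ₂ : ℝ}
    (h : IsMaximizer μ β X k v θ₁ θ₂) {q : Ω → ℝ} (hq : IsDensity μ q)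
    (hH : Hfun μ β q ≤ (k : EReal)) : (v : EReal) ≤ xInt μ X q := by
  obtain ⟨B, -, hB, hv, hle⟩ := hst.exists_lower_bound h hq hH
  refine (by exact_mod_cast hv : (v : EReal) ≤ ((∫ r, B r ∂μ : ℝ) : EReal)).trans
    (integral_le_eInt (hle.mono fun r hr => by exact_mod_cast hr) hB)

theorem ae_eq_pFam (hst : Standing μ β β' X p₀ b₀) (hψ : IsConjDeriv β β' ψ) {k v θ₁ θ₂ : ℝ}
    (h : IsMaximizer μ β X k v θ₁ θ₂) {q : Ω → ℝ} (hq : IsDensity μ q)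
    (hH : Hfun μ β q ≤ (k : EReal)) (hx : xInt μ X q = (v : EReal)) :
    q =ᵐ[μ] pFam ψ X θ₁ θ₂ := by
  obtain ⟨B, hBeq, hB, hv, hle⟩ := hst.exists_lower_bound h hq hH
  obtain ⟨x1, x2⟩ := hst.xInt_fin hq hx
  obtain ⟨q1, -, -⟩ := hst.hfun_fin hq (ne_top_of_le_ne_top (EReal.coe_ne_top _) hH)
  have h0 : 0 ≤ᵐ[μ] fun r => X r * q r - B r := hle.mono fun r hr => sub_nonneg.2 hr
  have h1 : ∫ r, (X r * q r - B r) ∂μ = 0 := by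
    refine le_antisymm ?_ (integral_nonneg_of_ae h0)
    rw [integral_sub x1 hB]; linarith
  filter_upwards [(integral_eq_zero_iff_of_nonneg_ae h0 (x1.sub hB)).1 h1, q1,
    hst.isMaximizer_ae_lt h] with r hr qr lr
  refine hst.eq_psi hψ r lr qr ?_
  have h2 : X r * q r = B r := by simpa [sub_eq_zero] using hr
  have h3 := hBeq r
  rw [← h2] at h3
  linarith

theorem vfun_eq (hst : Standing μ β β' X p₀ b₀) {k v θ₁ θ₂ : ℝ} (hk0 : 0 < k)
    (hkmax : (k : EReal) < kmax μ β X b₀) (h : IsMaximizer μ β X k v θ₁ θ₂) :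
    Vfun μ β X k = (v : EReal) := by
  refine le_antisymm ?_ (le_iInf fun q => hst.le_xInt_of_isMaximizer h q.2.1 q.2.2)
  by_contra hlt
  push Not at hlt
  obtain ⟨b, hb1, hb2⟩ := EReal.lt_iff_exists_real_btwn.1 hlt
  have hb0 : (b : EReal) < b₀ := by
    refine hb2.trans_le (iInf_le_of_le ⟨p₀, hst.dens₀, ?_⟩ hst.payoff₀.le)
    rw [hst.H₀]; exact_mod_cast hk0.le
  have hvb : v < b := by exact_mod_cast hb1
  have hbb : b < b₀ := by exact_mod_cast hb0
  have hm : essInfX μ X < (b : EReal) := by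
    obtain ⟨c, hc, u, w, hw, huw, k', hk', hle⟩ := hst.exists_kfin_neg hk0 hkmax
    have h1 := h.2.2.2 u w hw huw
    have : c < v := by
      by_contra hcv
      push Not at hcv
      nlinarith
    exact hc.trans (by exact_mod_cast this.trans hvb)
  obtain ⟨u, w, huw, hle⟩ := hst.exists_dual (f := k) hm (hb0.trans hst.ltM) fun q hq hqb hH =>
    absurd (hb2.trans_le (iInf_le_of_le ⟨q, hq, hH⟩ hqb.le)) (lt_irrefl _)
  have h1 := hst.le_kreal huw
  have hw : w < 0 := by
    by_contra hw
    push Not at hw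
    nlinarith
  have h2 := h.2.2.2 u w hw huw
  nlinarith

theorem pFam_eq_of_isMaximizer (hst : Standing μ β β' X p₀ b₀) (hψ : IsConjDeriv β β' ψ)
    {k v a t a' t' : ℝ} (h : IsMaximizer μ β X k v a t) (h' : IsMaximizer μ β X k v a' t') :
    pFam ψ X a t =ᵐ[μ] pFam ψ X a' t' := by
  have l1 := hst.isMaximizer_ae_lt h
  have l2 := hst.isMaximizer_ae_lt h'
  obtain ⟨h1, h2, h3, h4⟩ := h
  obtain ⟨k1, k2, k3, k4⟩ := h'
  obtain ⟨m1, -⟩ := hst.kfin_segment (e := 1 / 2) (by norm_num) (by norm_num) h2 k2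
  have hmid := h4 _ _ (by linarith : t + 1 / 2 * (t' - t) < 0) m1
  have hnn : 0 ≤ᵐ[μ] fun r => (conjβ β r (a + t * X r)).toReal +
      (conjβ β r (a' + t' * X r)).toReal -
      2 * (conjβ β r (a + 1 / 2 * (a' - a) + (t + 1 / 2 * (t' - t)) * X r)).toReal := by
    filter_upwards [h2.1, k2.1, m1.1] with r hr kr mr
    have := hst.conj_mid_le r (e := 1 / 2) (by norm_num) (by norm_num) hr kr
    rw [show a + t * X r + 1 / 2 * (a' + t' * X r - (a + t * X r)) =
      a + 1 / 2 * (a' - a) + (t + 1 / 2 * (t' - t)) * X r by ring, ← hst.coe_conj r mr,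
      EReal.coe_le_coe_iff] at this
    change (0 : ℝ) ≤ _
    linarith
  have hInt := (h2.2.add k2.2).sub (m1.2.const_mul 2)
  have hzero : ∫ r, ((conjβ β r (a + t * X r)).toReal + (conjβ β r (a' + t' * X r)).toReal -
      2 * (conjβ β r (a + 1 / 2 * (a' - a) + (t + 1 / 2 * (t' - t)) * X r)).toReal) ∂μ = 0 := by
    refine le_antisymm ?_ (integral_nonneg_of_ae hnn)
    rw [integral_sub (by exact h2.2.add k2.2) (m1.2.const_mul 2), integral_add h2.2 k2.2,
      integral_const_mul]
    simp only [KReal] at h3 k3 hmid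
    linarith
  filter_upwards [(integral_eq_zero_iff_of_nonneg_ae hnn hInt).1 hzero, l1, l2] with r hr r1 r2
  refine hst.psi_eq_of_conj_mid hψ r r1 r2 ?_
  rw [show a + t * X r + 1 / 2 * (a' + t' * X r - (a + t * X r)) =
      a + 1 / 2 * (a' - a) + (t + 1 / 2 * (t' - t)) * X r by ring]
  have hr : (_ : ℝ) = 0 := hr
  linarith

end Standing

theorem IsConjDeriv.tendsto_quotient {Ω : Type*} {β : Ω → ℝ → EReal} {β' ψ : Ω → ℝ → ℝ}
    (hψ : IsConjDeriv β β' ψ) {r : Ω} {τ : ℝ} (hτ : (τ : EReal) < derivTop β' r) (d : ℝ) :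
    Tendsto (fun e => ((conjβ β r (τ + e * d)).toReal - (conjβ β r τ).toReal) / e) (𝓝[>] 0)
      (𝓝 (ψ r τ * d)) := by
  have h1 : HasDerivAt (fun e : ℝ => τ + e * d) d 0 := by
    simpa using ((hasDerivAt_id (0 : ℝ)).mul_const d).const_add τ
  have h2 : HasDerivAt (fun e : ℝ => (conjβ β r (τ + e * d)).toReal) (ψ r τ * d) 0 := by
    refine HasDerivAt.comp (h₂ := fun t => (conjβ β r t).toReal) (0 : ℝ) ?_ h1
    simpa using hψ r τ hτ
  have h3 := h2.tendsto_slope_zero_right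
  simp only [zero_add, zero_mul, add_zero, smul_eq_mul] at h3
  exact h3.congr fun e => by rw [div_eq_inv_mul]

namespace Standing

variable {Ω : Type*} [MeasurableSpace Ω] {μ : Measure Ω} {β : Ω → ℝ → EReal}
  {β' : Ω → ℝ → ℝ} {ψ : Ω → ℝ → ℝ} {X p₀ : Ω → ℝ} {b₀ : ℝ}

theorem conj_quotient_le (hst : Standing μ β β' X p₀ b₀) {r : Ω} {τ τ' e : ℝ} (he : 0 < e)
    (he1 : e ≤ 1) (h : conjβ β r τ ≠ ⊤) (h' : conjβ β r τ' ≠ ⊤) :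
    ((conjβ β r (τ + e * (τ' - τ))).toReal - (conjβ β r τ).toReal) / e ≤
      (conjβ β r τ').toReal - (conjβ β r τ).toReal := by
  have h1 := EReal.toReal_le_toReal (hst.conj_mid_le r he.le he1 h h') (hst.conj_ne_bot _ _)
    (EReal.coe_ne_top _)
  rw [EReal.toReal_coe] at h1
  rw [div_le_iff₀ he]
  linarith

/-- A lower bound for the slopes of `K(θ) − θ₁` along a segment starting at `(θ₁, θ₂)` bounds
the directional derivative, which is expressed through the payoff of `p_{θ₁,θ₂}`. -/
theorem le_mul_integral_of_slope (hst : Standing μ β β' X p₀ b₀) (hψ : IsConjDeriv β β' ψ)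
    {θ₁ θ₂ a t m : ℝ} (hp : IsDensity μ (pFam ψ X θ₁ θ₂)) (h : KFin μ β X θ₁ θ₂)
    (hlt : ∀ᵐ r ∂μ, ((θ₁ + θ₂ * X r : ℝ) : EReal) < derivTop β' r)
    (h' : KFin μ β X a t) (hne : t ≠ θ₂)
    (hslope : ∀ e : ℝ, 0 < e → e ≤ 1 → KReal μ β X θ₁ θ₂ - θ₁ + e * m ≤
      KReal μ β X (θ₁ + e * (a - θ₁)) (θ₂ + e * (t - θ₂)) - (θ₁ + e * (a - θ₁))) :
    Integrable (fun r => X r * pFam ψ X θ₁ θ₂ r) μ ∧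
      m ≤ (t - θ₂) * ∫ r, X r * pFam ψ X θ₁ θ₂ r ∂μ := by
  set p := pFam ψ X θ₁ θ₂ with hpdef
  set e : ℕ → ℝ := fun n => 1 / ((n : ℝ) + 1) with he
  have hepos : ∀ n, 0 < e n := fun n => by simp only [he]; positivity
  have he1 : ∀ n, e n ≤ 1 := fun n => by
    simp only [he]
    rw [div_le_one (by positivity)]
    linarith [Nat.cast_nonneg (α := ℝ) n]
  have helim : Tendsto e atTop (𝓝[>] 0) :=
    tendsto_nhdsWithin_iff.2 ⟨tendsto_one_div_add_atTop_nhds_zero_nat,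
      Eventually.of_forall hepos⟩
  have harg : ∀ (c : ℝ) r, θ₁ + c * (a - θ₁) + (θ₂ + c * (t - θ₂)) * X r =
      θ₁ + θ₂ * X r + c * (a + t * X r - (θ₁ + θ₂ * X r)) := fun c r => by ring
  have hseg : ∀ n, KFin μ β X (θ₁ + e n * (a - θ₁)) (θ₂ + e n * (t - θ₂)) := fun n =>
    (hst.kfin_segment (hepos n).le (he1 n) h h').1
  set D : ℕ → Ω → ℝ := fun n r =>
    ((conjβ β r (θ₁ + e n * (a - θ₁) + (θ₂ + e n * (t - θ₂)) * X r)).toReal -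
      (conjβ β r (θ₁ + θ₂ * X r)).toReal) / e n with hD
  have hDi : ∀ n, Integrable (D n) μ := fun n => ((hseg n).2.sub h.2).div_const _
  set f : Ω → ℝ := fun r => (conjβ β r (a + t * X r)).toReal -
    (conjβ β r (θ₁ + θ₂ * X r)).toReal with hf
  have hfi : Integrable f μ := h'.2.sub h.2
  have hDint : ∀ n, m + (a - θ₁) ≤ ∫ r, D n r ∂μ := by
    intro n
    have := hslope _ (hepos n) (he1 n)
    simp only [hD]
    rw [integral_div, integral_sub (hseg n).2 h.2, le_div_iff₀ (hepos n)]
    simp only [KReal] at this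
    linarith
  have hlimit : Integrable (fun r => f r - p r * (a + t * X r - (θ₁ + θ₂ * X r))) μ ∧
      ∫ r, (f r - p r * (a + t * X r - (θ₁ + θ₂ * X r))) ∂μ ≤
        ∫ r, f r ∂μ - (m + (a - θ₁)) := by
    refine integrable_of_tendsto_of_integral_le (V := fun n r => f r - D n r) (B := fun _ => 0)
      (fun n => hfi.sub (hDi n)) (integrable_zero _ _ _) (fun n => ?_) ?_ (fun n => ?_)
    · filter_upwards [h.1, h'.1] with r hr kr
      have := hst.conj_quotient_le (hepos n) (he1 n) hr kr
      simp only [hD, hf, harg]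
      linarith
    · filter_upwards [hlt] with r hr
      have := (hψ.tendsto_quotient hr (a + t * X r - (θ₁ + θ₂ * X r))).comp helim
      simp only [hD, harg]
      exact tendsto_const_nhds.sub this
    · rw [integral_sub hfi (hDi n)]
      linarith [hDint n]
  obtain ⟨l1, l2⟩ := hlimit
  have hpd : Integrable (fun r => p r * (a + t * X r - (θ₁ + θ₂ * X r))) μ :=
    (hfi.sub l1).congr (ae_of_all _ fun r => by simp)
  have hnz : t - θ₂ ≠ 0 := sub_ne_zero.2 hne
  have hxp : Integrable (fun r => X r * p r) μ :=
    ((hpd.sub (hp.integrable.const_mul (a - θ₁))).div_const (t - θ₂)).congr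
      (ae_of_all _ fun r => by
        simp only [Pi.sub_apply]
        rw [div_eq_iff hnz]; ring)
  refine ⟨hxp, ?_⟩
  rw [integral_sub hfi hpd] at l2
  have : ∫ r, p r * (a + t * X r - (θ₁ + θ₂ * X r)) ∂μ =
      (a - θ₁) + (t - θ₂) * ∫ r, X r * p r ∂μ := by
    rw [show (fun r => p r * (a + t * X r - (θ₁ + θ₂ * X r))) =
      fun r => (a - θ₁) * p r + (t - θ₂) * (X r * p r) by funext r; ring,
      integral_add (hp.integrable.const_mul _) (hxp.const_mul _), integral_const_mul,
      integral_const_mul, hp.integral_eq_one, mul_one]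
  linarith

theorem hfun_pFam (hst : Standing μ β β' X p₀ b₀) (hψ : IsConjDeriv β β' ψ) {θ₁ θ₂ : ℝ}
    (hp : IsDensity μ (pFam ψ X θ₁ θ₂)) (h : KFin μ β X θ₁ θ₂)
    (hlt : ∀ᵐ r ∂μ, ((θ₁ + θ₂ * X r : ℝ) : EReal) < derivTop β' r)
    (hx : Integrable (fun r => X r * pFam ψ X θ₁ θ₂ r) μ) :
    Integrable (fun r => (β r (pFam ψ X θ₁ θ₂ r)).toReal) μ ∧
      (∀ᵐ r ∂μ, β r (pFam ψ X θ₁ θ₂ r) ≠ ⊤) ∧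
      ∫ r, (β r (pFam ψ X θ₁ θ₂ r)).toReal ∂μ =
        θ₁ + θ₂ * (∫ r, X r * pFam ψ X θ₁ θ₂ r ∂μ) - KReal μ β X θ₁ θ₂ := by
  have heq : (fun r => θ₁ * pFam ψ X θ₁ θ₂ r + θ₂ * (X r * pFam ψ X θ₁ θ₂ r) -
      (conjβ β r (θ₁ + θ₂ * X r)).toReal) =ᵐ[μ] fun r => (β r (pFam ψ X θ₁ θ₂ r)).toReal := by
    filter_upwards [hlt] with r hr
    have := (hst.psi_spec hψ r hr).2.2.2
    simp only [pFam]
    linarith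
  have hi := ((hp.integrable.const_mul θ₁).add (hx.const_mul θ₂)).sub h.2
  refine ⟨hi.congr heq, hlt.mono fun r hr => (hst.psi_spec hψ r hr).2.2.1, ?_⟩
  rw [← integral_congr_ae heq, integral_sub
    (by exact (hp.integrable.const_mul θ₁).add (hx.const_mul θ₂)) h.2, integral_add (hp.integrable.const_mul θ₁) (hx.const_mul θ₂),
    integral_const_mul, integral_const_mul, hp.integral_eq_one, mul_one]
  rfl

/-- The payoff of `p_{θ₁,θ₂}` is a subgradient of `K(a, t) − a` at `(θ₁, θ₂)`. -/
theorem subgradient (hst : Standing μ β β' X p₀ b₀) (hψ : IsConjDeriv β β' ψ) {θ₁ θ₂ : ℝ}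
    (hp : IsDensity μ (pFam ψ X θ₁ θ₂)) (h : KFin μ β X θ₁ θ₂)
    (hlt : ∀ᵐ r ∂μ, ((θ₁ + θ₂ * X r : ℝ) : EReal) < derivTop β' r)
    (hx : Integrable (fun r => X r * pFam ψ X θ₁ θ₂ r) μ) {a t : ℝ} (h' : KFin μ β X a t) :
    KReal μ β X θ₁ θ₂ - θ₁ + (∫ r, X r * pFam ψ X θ₁ θ₂ r ∂μ) * (t - θ₂) ≤
      KReal μ β X a t - a := by
  obtain ⟨h1, h2, h3⟩ := hst.hfun_pFam hψ hp h hlt hx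
  have hle : ∫ r, (a * pFam ψ X θ₁ θ₂ r + t * (X r * pFam ψ X θ₁ θ₂ r) -
      (β r (pFam ψ X θ₁ θ₂ r)).toReal) ∂μ ≤ KReal μ β X a t := by
    refine integral_mono_ae (((hp.integrable.const_mul a).add (hx.const_mul t)).sub h1) h'.2 ?_
    filter_upwards [h2, h'.1] with r hr kr
    have := hst.young r hr kr
    change _ ≤ (conjβ β r (a + t * X r)).toReal
    linarith
  rw [integral_sub (by exact (hp.integrable.const_mul a).add (hx.const_mul t)) h1,
    integral_add (hp.integrable.const_mul a) (hx.const_mul t),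
    integral_const_mul, integral_const_mul, hp.integral_eq_one, mul_one, h3] at hle
  linarith

theorem hasDerivWithinAt_gfun (hst : Standing μ β β' X p₀ b₀) (hψ : IsConjDeriv β β' ψ)
    {θ₁ θ₂ a t : ℝ} (hp : IsDensity μ (pFam ψ X θ₁ θ₂)) (h : KFin μ β X θ₁ θ₂)
    (hlt : ∀ᵐ r ∂μ, ((θ₁ + θ₂ * X r : ℝ) : EReal) < derivTop β' r)
    (hx : Integrable (fun r => X r * pFam ψ X θ₁ θ₂ r) μ) (h' : KFin μ β X a t) (ht : θ₂ < t) :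
    HasDerivWithinAt (fun t => (Gfun μ β X t).toReal) (∫ r, X r * pFam ψ X θ₁ θ₂ r ∂μ)
      (Ici θ₂) θ₂ := by
  set p := pFam ψ X θ₁ θ₂ with hpdef
  set x := ∫ r, X r * p r ∂μ with hxdef
  have hg : (Gfun μ β X θ₂).toReal = KReal μ β X θ₁ θ₂ - θ₁ := by
    refine le_antisymm (hst.gfun_toReal_le h) (hst.le_gfun_toReal h fun a' ha' => ?_)
    have := hst.subgradient hψ hp h hlt hx ha'
    linarith
  have hpos : 0 < t - θ₂ := sub_pos.2 ht
  have harg : ∀ (c : ℝ) r, θ₁ + c * (a - θ₁) + (θ₂ + c * (t - θ₂)) * X r =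
      θ₁ + θ₂ * X r + c * (a + t * X r - (θ₁ + θ₂ * X r)) := fun c r => by ring
  set D : ℝ → Ω → ℝ := fun e r =>
    ((conjβ β r (θ₁ + e * (a - θ₁) + (θ₂ + e * (t - θ₂)) * X r)).toReal -
      (conjβ β r (θ₁ + θ₂ * X r)).toReal) / e with hD
  set f : Ω → ℝ := fun r => (conjβ β r (a + t * X r)).toReal -
    (conjβ β r (θ₁ + θ₂ * X r)).toReal with hf
  have hfi : Integrable f μ := h'.2.sub h.2
  set l : Ω → ℝ := fun r => p r * (a + t * X r - (θ₁ + θ₂ * X r)) with hl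
  have hleq : l = fun r => (a - θ₁) * p r + (t - θ₂) * (X r * p r) := by
    funext r; simp only [hl]; ring
  have hli : Integrable l μ := by
    rw [hleq]; exact (hp.integrable.const_mul _).add (hx.const_mul _)
  have hlint : ∫ r, l r ∂μ = (a - θ₁) + (t - θ₂) * x := by
    rw [hleq, integral_add (hp.integrable.const_mul _) (hx.const_mul _), integral_const_mul,
      integral_const_mul, hp.integral_eq_one, mul_one]
  have hsmall : ∀ᶠ e : ℝ in 𝓝[>] 0, 0 < e ∧ e ≤ 1 := by
    filter_upwards [self_mem_nhdsWithin, nhdsWithin_le_nhds (Iic_mem_nhds one_pos)] with e h1 h2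
    exact ⟨h1, h2⟩
  have hlim : Tendsto (fun e => ∫ r, D e r ∂μ) (𝓝[>] 0) (𝓝 ((a - θ₁) + (t - θ₂) * x)) := by
    rw [← hlint]
    refine tendsto_integral_filter_of_dominated_convergence (fun r => |l r| + |f r|) ?_ ?_
      (hli.abs.add hfi.abs) ?_
    · filter_upwards [hsmall] with e he
      exact (((hst.kfin_segment he.1.le he.2 h h').1.2.sub h.2).div_const _).aestronglyMeasurable
    · filter_upwards [hsmall] with e he
      filter_upwards [h.1, h'.1, hlt, (hst.kfin_segment he.1.le he.2 h h').1.1] with r hr kr lr sr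
      have h1 := hst.conj_quotient_le he.1 he.2 hr kr
      obtain ⟨-, -, h2, h3⟩ := hst.psi_spec hψ r lr
      have h4 := hst.young r h2 sr
      rw [← harg] at h1
      have h5 : l r ≤ D e r := by
        simp only [hD, hl, hpdef, pFam]
        rw [le_div_iff₀ he.1, h3]
        rw [harg] at h4 ⊢
        linarith
      rw [Real.norm_eq_abs]
      refine abs_le.2 ⟨?_, ?_⟩
      · linarith [neg_abs_le (l r), abs_nonneg (f r)]
      · exact h1.trans (by linarith [le_abs_self (f r), abs_nonneg (l r)])
    · filter_upwards [hlt] with r hr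
      simp only [hD, harg]
      exact hψ.tendsto_quotient hr _
  have hc : Tendsto (fun s => (s - θ₂) / (t - θ₂)) (𝓝[>] θ₂) (𝓝[>] 0) := by
    refine tendsto_nhdsWithin_iff.2 ⟨?_, ?_⟩
    · have : Tendsto (fun s => (s - θ₂) / (t - θ₂)) (𝓝 θ₂) (𝓝 ((θ₂ - θ₂) / (t - θ₂))) :=
        Continuous.tendsto (by fun_prop) θ₂
      rw [sub_self, zero_div] at this
      exact this.mono_left nhdsWithin_le_nhds
    · filter_upwards [self_mem_nhdsWithin] with s hs
      exact div_pos (sub_pos.2 hs) hpos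
  have hup : Tendsto (fun s => (∫ r, D ((s - θ₂) / (t - θ₂)) r ∂μ - (a - θ₁)) / (t - θ₂))
      (𝓝[>] θ₂) (𝓝 x) := by
    have := ((hlim.comp hc).sub_const (a - θ₁)).div_const (t - θ₂)
    rwa [show ((a - θ₁) + (t - θ₂) * x - (a - θ₁)) / (t - θ₂) = x by
      rw [add_sub_cancel_left, mul_div_cancel_left₀ _ hpos.ne']] at this
  rw [← hasDerivWithinAt_Ioi_iff_Ici, hasDerivWithinAt_iff_tendsto_slope' (by simp)]
  refine tendsto_of_tendsto_of_tendsto_of_le_of_le' tendsto_const_nhds hup ?_ ?_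
  all_goals
    filter_upwards [hc.eventually hsmall, self_mem_nhdsWithin] with s hs hsθ
    obtain ⟨he0, he1⟩ := hs
    have hsθ : 0 < s - θ₂ := sub_pos.2 hsθ
    have hseg := (hst.kfin_segment he0.le he1 h h').1
    have hs' : θ₂ + (s - θ₂) / (t - θ₂) * (t - θ₂) = s := by
      rw [div_mul_cancel₀ _ hpos.ne']; ring
    rw [slope_def_field, hg]
  · rw [le_div_iff₀ hsθ]
    have := hst.le_gfun_toReal (hs' ▸ hseg) (fun a' ha' => hst.subgradient hψ hp h hlt hx ha')
    linarith
  · have h1 := hst.gfun_toReal_le hseg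
    rw [hs'] at h1
    rw [div_le_div_iff₀ hsθ hpos]
    have h2 : ∫ r, D ((s - θ₂) / (t - θ₂)) r ∂μ =
        (KReal μ β X (θ₁ + (s - θ₂) / (t - θ₂) * (a - θ₁)) s - KReal μ β X θ₁ θ₂) /
          ((s - θ₂) / (t - θ₂)) := by
      simp only [hD]
      rw [integral_div, integral_sub hseg.2 h.2, hs']
      rfl
    rw [h2]
    generalize KReal μ β X (θ₁ + (s - θ₂) / (t - θ₂) * (a - θ₁)) s = K1 at *
    have h3 : ((K1 - KReal μ β X θ₁ θ₂) / ((s - θ₂) / (t - θ₂)) - (a - θ₁)) * (s - θ₂) =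
        (K1 - KReal μ β X θ₁ θ₂ - (s - θ₂) / (t - θ₂) * (a - θ₁)) * (t - θ₂) := by
      field_simp
    rw [h3]
    exact mul_le_mul_of_nonneg_right (by linarith) hpos.le

end Standing

namespace Standing

variable {Ω : Type*} [MeasurableSpace Ω] {μ : Measure Ω} {β : Ω → ℝ → EReal}
  {β' : Ω → ℝ → ℝ} {ψ : Ω → ℝ → ℝ} {X p₀ : Ω → ℝ} {b₀ : ℝ}

theorem mul_le_mul_payoff (hst : Standing μ β β' X p₀ b₀) (hψ : IsConjDeriv β β' ψ)
    {k v θ₁ θ₂ a t : ℝ} (hp : IsDensity μ (pFam ψ X θ₁ θ₂)) (h : IsMaximizer μ β X k v θ₁ θ₂)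
    (h' : KFin μ β X a t) (ht : t < 0) (hne : t ≠ θ₂) :
    Integrable (fun r => X r * pFam ψ X θ₁ θ₂ r) μ ∧
      v * (t - θ₂) ≤ (t - θ₂) * ∫ r, X r * pFam ψ X θ₁ θ₂ r ∂μ := by
  refine hst.le_mul_integral_of_slope hψ hp h.2.1 (hst.isMaximizer_ae_lt h) h' hne ?_
  intro e he he1
  have h1 := h.2.2.2 _ (θ₂ + e * (t - θ₂)) (by nlinarith [h.1])
    (hst.kfin_segment he.le he1 h.2.1 h').1
  linarith [h.2.2.1]

theorem exists_kfin_right_neg (hst : Standing μ β β' X p₀ b₀) {θ₁ θ₂ : ℝ} (hθ : θ₂ < 0)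
    (h : KFin μ β X θ₁ θ₂) : ∃ a t, θ₂ < t ∧ t < 0 ∧ KFin μ β X a t := by
  obtain ⟨u, w, h1, h2⟩ := hst.exists_kfin_right hθ
  rcases lt_or_ge w 0 with hw | hw
  · exact ⟨u, w, h1, hw, h2⟩
  · have hpos : 0 < 2 * (w - θ₂) := by linarith
    have he : 0 ≤ -θ₂ / (2 * (w - θ₂)) := div_nonneg (by linarith) hpos.le
    have he1 : -θ₂ / (2 * (w - θ₂)) ≤ 1 := by rw [div_le_one hpos]; linarith
    have hmid : θ₂ + -θ₂ / (2 * (w - θ₂)) * (w - θ₂) = θ₂ / 2 := by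
      have : w - θ₂ ≠ 0 := by linarith
      field_simp
      ring
    exact ⟨_, _, by rw [hmid]; linarith, by rw [hmid]; linarith,
      (hst.kfin_segment he he1 h h2).1⟩

/-- On the segment joining a smaller point of `Θ₂` to `θ₂`, the right derivative of `G` at the
smaller point is at most the slope of the chord. -/
theorem deriv_mul_le_chord (hst : Standing μ β β' X p₀ b₀) {a₀ t₀ a t g' : ℝ}
    (h₀ : KFin μ β X a₀ t₀) (h : KFin μ β X a t) (hlt : t₀ < t)
    (hg : HasDerivWithinAt (fun t => (Gfun μ β X t).toReal) g' (Ici t₀) t₀) :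
    g' * (t - t₀) ≤ KReal μ β X a t - a - (Gfun μ β X t₀).toReal := by
  have hpos : 0 < t - t₀ := sub_pos.2 hlt
  rw [← hasDerivWithinAt_Ioi_iff_Ici, hasDerivWithinAt_iff_tendsto_slope' (by simp)] at hg
  rw [← le_div_iff₀ hpos]
  refine le_of_tendsto hg ?_
  filter_upwards [self_mem_nhdsWithin, nhdsWithin_le_nhds (Iic_mem_nhds hlt)] with s hs hst'
  have hs : 0 < s - t₀ := sub_pos.2 hs
  have hst' : s ≤ t := hst'
  rw [slope_def_field, div_le_div_iff₀ hs hpos]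
  set e := (s - t₀) / (t - t₀) with he
  have he0 : 0 ≤ e := (div_pos hs hpos).le
  have he1 : e ≤ 1 := by rw [he, div_le_one hpos]; linarith
  have hes : e * (t - t₀) = s - t₀ := div_mul_cancel₀ _ hpos.ne'
  have hst₂ : t₀ + e * (t - t₀) = s := by rw [hes]; ring
  have hupper : ∀ a', KFin μ β X a' t₀ → (Gfun μ β X s).toReal ≤
      (1 - e) * (KReal μ β X a' t₀ - a') + e * (KReal μ β X a t - a) := by
    intro a' ha'
    obtain ⟨h1, h2⟩ := hst.kfin_segment he0 he1 ha' h
    have h3 := hst.gfun_toReal_le h1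
    rw [hst₂] at h2 h3
    linarith
  have hkey : (Gfun μ β X s).toReal ≤
      (1 - e) * (Gfun μ β X t₀).toReal + e * (KReal μ β X a t - a) := by
    rcases he1.eq_or_lt with h1 | h1
    · have := hupper a₀ h₀
      rw [h1] at this ⊢
      linarith
    · have h2 : 0 < 1 - e := by linarith
      have h3 := hst.le_gfun_toReal h₀
        (c := ((Gfun μ β X s).toReal - e * (KReal μ β X a t - a)) / (1 - e)) fun a' ha' => by
          rw [div_le_iff₀ h2]
          linarith [hupper a' ha']
      rw [div_le_iff₀ h2] at h3
      linarith
  have h4 : (Gfun μ β X s).toReal - (Gfun μ β X t₀).toReal ≤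
      e * (KReal μ β X a t - a - (Gfun μ β X t₀).toReal) := by linarith
  calc ((Gfun μ β X s).toReal - (Gfun μ β X t₀).toReal) * (t - t₀)
      ≤ e * (KReal μ β X a t - a - (Gfun μ β X t₀).toReal) * (t - t₀) :=
        mul_le_mul_of_nonneg_right h4 hpos.le
    _ = (KReal μ β X a t - a - (Gfun μ β X t₀).toReal) * (e * (t - t₀)) := by ring
    _ = _ := by rw [hes]

/-- In the exceptional case a maximiser sits over the left endpoint of `Θ₂`. -/
theorem eq_of_isLeast (hst : Standing μ β β' X p₀ b₀) {k v θ₁ θ₂ tmin g' : ℝ}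
    (h : IsMaximizer μ β X k v θ₁ θ₂) (hleast : IsLeast (Theta2 μ β X) tmin)
    (hg : HasDerivWithinAt (fun t => (Gfun μ β X t).toReal) g' (Ici tmin) tmin)
    (hk : -(Gfun μ β X tmin).toReal + tmin * g' < k) : θ₂ = tmin := by
  have hle : tmin ≤ θ₂ := hleast.2 (hst.mem_theta2_iff.2 ⟨θ₁, h.2.1⟩)
  by_contra hne
  have hlt : tmin < θ₂ := lt_of_le_of_ne hle (Ne.symm hne)
  obtain ⟨a₀, ha₀⟩ := hst.mem_theta2_iff.1 hleast.1
  have h1 := hst.deriv_mul_le_chord ha₀ h.2.1 hlt hg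
  have h2 := hst.le_gfun_toReal ha₀ (c := v * tmin - k) fun a ha => by
    linarith [h.2.2.2 a tmin (hlt.trans h.1) ha]
  have h3 := h.2.2.1
  have h4 : g' ≤ v := by
    refine le_of_mul_le_mul_right ?_ (sub_pos.2 hlt)
    linarith
  nlinarith [h.1]

end Standing

/-- Theorem 3(i) of the paper. Suppose the worst case localiser
`q̂_k = p_{θ₁,θ₂}` is a density. Then it is a worst case density for `k`, unless
`θ_min ∈ Θ₂`, the right derivative `G'₊(θ_min)` is finite (> −∞), and `k > k_cr`, where
`k_cr = −G(θ_min) + θ_min G'₊(θ_min)`. In the latter case `q̂_k = q̂_{k_cr} = q_{θ_min}`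
and no worst case density exists for `k`. -/
theorem wcl_density_is_wcd {Ω : Type*} [MeasurableSpace Ω] (μ : Measure Ω)
    (β : Ω → ℝ → EReal) (β' : Ω → ℝ → ℝ) (ψ : Ω → ℝ → ℝ) (X : Ω → ℝ) (p₀ : Ω → ℝ) (b₀ : ℝ)
    (hst : Standing μ β β' X p₀ b₀) (hψ : IsConjDeriv β β' ψ)
    (k : ℝ) (hk0 : 0 < k) (hkmax : (k : EReal) < kmax μ β X b₀)
    (θ₁ θ₂ : ℝ) (hwcl : IsWCLParam μ β X k θ₁ θ₂)
    (hq : IsDensity μ (pFam ψ X θ₁ θ₂)) :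
    -- unless the exceptional case holds, `q̂_k` is a worst case density for `k`
    ((¬ ∃ tmin g' : ℝ, IsLeast (Theta2 μ β X) tmin ∧
        HasDerivWithinAt (fun t => (Gfun μ β X t).toReal) g' (Ici tmin) tmin ∧
        -(Gfun μ β X tmin).toReal + tmin * g' < k) →
      Hfun μ β (pFam ψ X θ₁ θ₂) ≤ (k : EReal) ∧
      xInt μ X (pFam ψ X θ₁ θ₂) = Vfun μ β X k) ∧
    -- in the exceptional case, `q̂_k = q̂_{k_cr} = q_{θ_min}` and no WCD exists for `k`
    (∀ tmin g' : ℝ, IsLeast (Theta2 μ β X) tmin →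
      HasDerivWithinAt (fun t => (Gfun μ β X t).toReal) g' (Ici tmin) tmin →
      -(Gfun μ β X tmin).toReal + tmin * g' < k →
      ((∀ θ₁' θ₂' : ℝ,
          IsWCLParam μ β X (-(Gfun μ β X tmin).toReal + tmin * g') θ₁' θ₂' →
          pFam ψ X θ₁ θ₂ =ᵐ[μ] pFam ψ X θ₁' θ₂') ∧
       (∀ θb₁ : ℝ, Kfun μ β X θb₁ tmin - (θb₁ : EReal) = Gfun μ β X tmin →
          pFam ψ X θ₁ θ₂ =ᵐ[μ] pFam ψ X θb₁ tmin) ∧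
       ¬ ∃ p : Ω → ℝ, IsDensity μ p ∧ Hfun μ β p ≤ (k : EReal) ∧
          xInt μ X p = Vfun μ β X k)) := by
  obtain ⟨_, _, u, w, hw, huw, _⟩ := hst.exists_kfin_neg hk0 hkmax
  obtain ⟨v, hv⟩ := hst.exists_isMaximizer hwcl hw huw
  have hlt := hst.isMaximizer_ae_lt hv
  have hV := hst.vfun_eq hk0 hkmax hv
  obtain ⟨hθ, hK, hval, hmax⟩ := id hv
  obtain ⟨a, t, hθt, ht, hat⟩ := hst.exists_kfin_right_neg hθ hK
  obtain ⟨hx, hxv⟩ := hst.mul_le_mul_payoff hψ hq hv hat ht hθt.ne'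
  obtain ⟨hβi, hβf, hβ⟩ := hst.hfun_pFam hψ hq hK hlt hx
  have hder := hst.hasDerivWithinAt_gfun hψ hq hK hlt hx hat hθt
  have hsub := fun a t (h : KFin μ β X a t) => hst.subgradient hψ hq hK hlt hx h
  have hxI := xInt_eq_integral hx
  have hG := hst.gfun_toReal_eq hv
  set x := ∫ r, X r * pFam ψ X θ₁ θ₂ r ∂μ with hxdef
  have hvx : v ≤ x := by
    rw [mul_comm] at hxv
    exact le_of_mul_le_mul_left hxv (sub_pos.2 hθt)
  constructor
  · intro hno
    have hxv' : x = v := by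
      refine le_antisymm ?_ hvx
      by_cases hleft : ∃ s ∈ Theta2 μ β X, s < θ₂
      · obtain ⟨s, hs, hsθ⟩ := hleft
        obtain ⟨c, hc⟩ := hst.mem_theta2_iff.1 hs
        have h1 := (hst.mul_le_mul_payoff hψ hq hv hc (hsθ.trans hθ) hsθ.ne).2
        rw [mul_comm] at h1
        exact (mul_le_mul_left_of_neg (sub_neg.2 hsθ)).1 h1
      · push Not at hleft
        by_contra hgt
        push Not at hgt
        refine hno ⟨θ₂, x, ⟨hst.mem_theta2_iff.2 ⟨θ₁, hK⟩, hleft⟩, hder, ?_⟩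
        rw [hG]
        nlinarith
    refine ⟨?_, by rw [hxI, hV, hxv']⟩
    rw [hst.hfun_eq hβf hβi, hβ, EReal.coe_le_coe_iff]
    rw [hxv']
    linarith
  · intro tmin g' hleast hg hk
    obtain rfl := hst.eq_of_isLeast hv hleast hg hk
    obtain rfl : g' = x := (uniqueDiffOn_Ici θ₂ θ₂ self_mem_Ici).eq_deriv _ hg hder
    have hcr : IsMaximizer μ β X (-(Gfun μ β X θ₂).toReal + θ₂ * x) x θ₁ θ₂ := by
      refine ⟨hθ, hK, by rw [hG]; ring, fun c s _ hcs => ?_⟩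
      rw [hG]
      linarith [hsub c s hcs]
    refine ⟨fun θ₁' θ₂' h' => ?_, fun θb hb => ?_, ?_⟩
    · obtain ⟨v', hv'⟩ := hst.exists_isMaximizer h' hθ hK
      obtain rfl := hcr.value_unique hv'
      exact hst.pFam_eq_of_isMaximizer hψ hcr hv'
    · rw [← hst.coe_gfun hK, hG] at hb
      have hbK : KFin μ β X θb θ₂ := hst.kfin_of_ne_top fun htop => by
        rw [htop, EReal.top_sub_coe] at hb
        exact EReal.coe_ne_top _ hb.symm
      rw [hst.kfun_eq hbK, ← EReal.coe_sub, EReal.coe_eq_coe_iff] at hb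
      exact hst.pFam_eq_of_isMaximizer hψ hv ⟨hθ, hbK, by rw [hb, hval], hmax⟩
    · rintro ⟨p, hp, hpH, hpx⟩
      rw [hV] at hpx
      have h1 := hst.ae_eq_pFam hψ hv hp hpH hpx
      have h2 : x = v := by
        rw [← (hst.xInt_fin hp hpx).2]
        exact integral_congr_ae (h1.mono fun r hr => by simp only [hr])
      rw [hG, h2] at hk
      linarith
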